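/- Let m ≥ 1, κ_j > 0 and φ_j ∈ C^∞([−1,1]) for j = 1,…,m, and let α, β be real with α ≥ β and α ≥ κ_1+⋯+κ_m − 1/2. Write |κ| = κ_1+⋯+κ_m. Then there exists a constant c > 0, depending only on α, β, m, the κ_j and the φ_j, such that for all integers n ≥ 1, all a = (a_1,…,a_m) with every a_j ≠ 0 and |a| := |a_1|+⋯+|a_m| ≤ 1, and all real x with |x| + |a| ≤ 1: |∫_{[−1,1]^m} P_n^{(α,β)}(a_1t_1+⋯+a_mt_m + x) ∏_{j=1}^m φ_j(t_j)(1−t_j²)^{κ_j−1} dt| ≤ c n^{α−2|κ|} (1 + n√(1−|a|−|x|))^{−α−1/2+|κ|} ∏_{j=1}^m (|a_j| + n^{−1}√(1−|a|−|x|) + n^{−2})^{−κ_j}. -/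

import Mathlib

open MeasureTheory Finset Real

/-- Generalized binomial coefficient `C(x, k) = x (x-1) ⋯ (x-k+1) / k!`. -/
noncomputable def genBinom (x : ℝ) (k : ℕ) : ℝ :=
  (∏ i ∈ Finset.range k, (x - i)) / (Nat.factorial k)

/-- Jacobi polynomial `P_n^{(a,b)}(t)`. -/
noncomputable def jacobiP (n : ℕ) (a b t : ℝ) : ℝ :=
  ∑ m ∈ Finset.range (n + 1),
    genBinom (n + a) (n - m) * genBinom (n + b) m * ((t - 1) / 2) ^ m * ((t + 1) / 2) ^ (n - m)

/-- The cube `[-1,1]^m`. -/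
def cube (m : ℕ) : Set (Fin m → ℝ) := Set.univ.pi fun _ => Set.Icc (-1) 1

lemma genBinom_succ (x : ℝ) (k : ℕ) :
    ((k : ℝ) + 1) * genBinom x (k + 1) = genBinom x k * (x - k) := by
  unfold genBinom
  rw [Finset.prod_range_succ, Nat.factorial_succ]
  have h : ((k.factorial : ℕ) : ℝ) ≠ 0 := by exact_mod_cast k.factorial_ne_zero
  have h' : (k : ℝ) + 1 ≠ 0 := by positivity
  push_cast
  field_simp

lemma continuous_jacobiP (n : ℕ) (a b : ℝ) : Continuous (jacobiP n a b) := by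
  unfold jacobiP
  fun_prop

lemma jacobiP_neg (n : ℕ) (a b t : ℝ) : jacobiP n a b (-t) = (-1) ^ n * jacobiP n b a t := by
  unfold jacobiP
  rw [← Finset.sum_range_reflect, Finset.mul_sum]
  refine Finset.sum_congr rfl fun m hm => ?_
  have hm' : m ≤ n := by simpa [Nat.lt_succ_iff] using hm
  have h1 : n + 1 - 1 - m = n - m := by omega
  have h2 : n - (n - m) = m := by omega
  rw [h1, h2]
  have h3 : ((-t - 1) / 2 : ℝ) = (-1) * ((t + 1) / 2) := by ring
  have h4 : ((-t + 1) / 2 : ℝ) = (-1) * ((t - 1) / 2) := by ring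
  have h5 : (-1 : ℝ) ^ n = (-1) ^ (n - m) * (-1) ^ m := by
    rw [← pow_add]; congr 1; omega
  rw [h3, h4, mul_pow, mul_pow, h5]
  ring

/-- Termwise derivative of a homogeneous form in `(t - 1) / 2` and `(t + 1) / 2`. -/
lemma hasDerivAt_sum_pow_mul_pow (c : ℕ → ℝ) (n : ℕ) (t : ℝ) :
    HasDerivAt (fun t : ℝ => ∑ m ∈ range (n + 1), c m * ((t - 1) / 2) ^ m * ((t + 1) / 2) ^ (n - m))
      (∑ m ∈ range (n + 1), c m * (m * ((t - 1) / 2) ^ (m - 1) * (1 / 2) * ((t + 1) / 2) ^ (n - m) +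
        ((t - 1) / 2) ^ m * ((n - m : ℕ) * ((t + 1) / 2) ^ (n - m - 1) * (1 / 2)))) t := by
  refine HasDerivAt.fun_sum fun m _ => ?_
  simp only [mul_assoc (c m)]
  have h1 : HasDerivAt (fun t : ℝ => (t - 1) / 2) (1 / 2) t :=
    ((hasDerivAt_id t).sub_const 1).div_const 2
  have h2 : HasDerivAt (fun t : ℝ => (t + 1) / 2) (1 / 2) t :=
    ((hasDerivAt_id t).add_const 1).div_const 2
  exact ((h1.fun_pow m).fun_mul (h2.fun_pow (n - m))).const_mul (c m)

lemma hasDerivAt_jacobiP_succ (n : ℕ) (a b t : ℝ) :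
    HasDerivAt (jacobiP (n + 1) a b)
      ((n + a + b + 2) / 2 * jacobiP n (a + 1) (b + 1) t) t := by
  have h := hasDerivAt_sum_pow_mul_pow
    (fun m => genBinom ((n + 1 : ℕ) + a) (n + 1 - m) * genBinom ((n + 1 : ℕ) + b) m) (n + 1) t
  refine HasDerivAt.congr_deriv (f := jacobiP (n + 1) a b) h (Eq.symm ?_)
  simp only [mul_add, Finset.sum_add_distrib]
  rw [Finset.sum_range_succ' _ (n + 1), Finset.sum_range_succ _ (n + 1)]
  simp only [Nat.cast_zero, zero_mul, mul_zero, add_zero, Nat.sub_self]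
  rw [← Finset.sum_add_distrib]
  unfold jacobiP
  rw [Finset.mul_sum]
  refine Finset.sum_congr rfl fun m hm => ?_
  obtain ⟨k, rfl⟩ : ∃ k, n = m + k := ⟨n - m, by have := Finset.mem_range.1 hm; omega⟩
  have e1 : m + k + 1 - (m + 1) = k := by omega
  have e2 : m + k + 1 - m = k + 1 := by omega
  have e3 : m + k - m = k := by omega
  rw [e1, e2, e3]
  simp only [Nat.add_sub_cancel]
  have g1 := genBinom_succ ((m + k + 1 : ℕ) + a) k
  have g2 := genBinom_succ ((m + k + 1 : ℕ) + b) m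
  have e4 : ((m + k : ℕ) : ℝ) + (a + 1) = (m + k + 1 : ℕ) + a := by push_cast; ring
  have e5 : ((m + k : ℕ) : ℝ) + (b + 1) = (m + k + 1 : ℕ) + b := by push_cast; ring
  rw [e4, e5]
  push_cast at g1 g2 ⊢
  generalize genBinom (↑m + ↑k + 1 + a) (k + 1) = A1 at *
  generalize genBinom (↑m + ↑k + 1 + b) (m + 1) = B1 at *
  generalize genBinom (↑m + ↑k + 1 + a) k = A0 at *
  generalize genBinom (↑m + ↑k + 1 + b) m = B0 at *
  linear_combination (-1 / 2 * A0 * ((t - 1) / 2) ^ m * ((t + 1) / 2) ^ k) * g2 +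
    (-1 / 2 * B0 * ((t - 1) / 2) ^ m * ((t + 1) / 2) ^ k) * g1

lemma deriv_jacobiP_identity (n : ℕ) (a b t : ℝ) :
    ∃ D, HasDerivAt (jacobiP n (a + 1) (b + 1)) D t ∧
      (1 - t ^ 2) * D + (b - a - (a + b + 2) * t) * jacobiP n (a + 1) (b + 1) t =
        -2 * (n + 1) * jacobiP (n + 1) a b t := by
  refine ⟨_, hasDerivAt_sum_pow_mul_pow
    (fun m => genBinom (n + (a + 1)) (n - m) * genBinom (n + (b + 1)) m) n t, ?_⟩
  unfold jacobiP
  set x := (t - 1) / 2 with hx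
  set y := (t + 1) / 2 with hy
  have hxy : (1 - t ^ 2) = -4 * x * y := by rw [hx, hy]; ring
  have hl : (b - a - (a + b + 2) * t) = -2 * ((b + 1) * x + (a + 1) * y) := by rw [hx, hy]; ring
  rw [hxy, hl]
  have key : ∀ m ∈ range (n + 1),
      -4 * x * y * (genBinom (n + (a + 1)) (n - m) * genBinom (n + (b + 1)) m *
        (m * x ^ (m - 1) * (1 / 2) * y ^ (n - m) +
          x ^ m * ((n - m : ℕ) * y ^ (n - m - 1) * (1 / 2)))) +
      -2 * ((b + 1) * x + (a + 1) * y) * (genBinom (n + (a + 1)) (n - m) *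
        genBinom (n + (b + 1)) m * x ^ m * y ^ (n - m)) =
      -2 * (((m + 1 : ℕ) : ℝ) * (genBinom ((n + 1 : ℕ) + a) (n + 1 - (m + 1)) *
          genBinom ((n + 1 : ℕ) + b) (m + 1) * x ^ (m + 1) * y ^ (n + 1 - (m + 1)))) +
      -2 * (((n + 1 - m : ℕ) : ℝ) * (genBinom ((n + 1 : ℕ) + a) (n + 1 - m) *
          genBinom ((n + 1 : ℕ) + b) m * x ^ m * y ^ (n + 1 - m))) := by
    intro m hm
    obtain ⟨k, rfl⟩ : ∃ k, n = m + k := ⟨n - m, by have := Finset.mem_range.1 hm; omega⟩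
    have e1 : m + k + 1 - (m + 1) = k := by omega
    have e2 : m + k + 1 - m = k + 1 := by omega
    have e3 : m + k - m = k := by omega
    rw [e1, e2, e3]
    have g1 := genBinom_succ ((m + k + 1 : ℕ) + a) k
    have g2 := genBinom_succ ((m + k + 1 : ℕ) + b) m
    have e4 : ((m + k : ℕ) : ℝ) + (a + 1) = (m + k + 1 : ℕ) + a := by push_cast; ring
    have e5 : ((m + k : ℕ) : ℝ) + (b + 1) = (m + k + 1 : ℕ) + b := by push_cast; ring
    rw [e4, e5]
    have hxm : (m : ℝ) * (x * x ^ (m - 1)) = m * x ^ m := by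
      cases m with
      | zero => simp
      | succ m => simp [pow_succ']
    have hyk : (k : ℝ) * (y * y ^ (k - 1)) = k * y ^ k := by
      cases k with
      | zero => simp
      | succ k => simp [pow_succ']
    push_cast at g1 g2 ⊢
    generalize genBinom (↑m + ↑k + 1 + a) (k + 1) = A1 at *
    generalize genBinom (↑m + ↑k + 1 + b) (m + 1) = B1 at *
    generalize genBinom (↑m + ↑k + 1 + a) k = A0 at *
    generalize genBinom (↑m + ↑k + 1 + b) m = B0 at *
    rw [pow_succ x m, pow_succ y k]
    linear_combination (-2 * y * y ^ k * A0 * B0) * hxm + (-2 * x * x ^ m * A0 * B0) * hyk +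
      (2 * A0 * x * x ^ m * y ^ k) * g2 + (2 * B0 * x ^ m * y * y ^ k) * g1
  rw [Finset.mul_sum, Finset.mul_sum, ← Finset.sum_add_distrib, Finset.sum_congr rfl key,
    Finset.sum_add_distrib, ← Finset.mul_sum, ← Finset.mul_sum]
  set P : ℕ → ℝ := fun m => genBinom ((n + 1 : ℕ) + a) (n + 1 - m) *
    genBinom ((n + 1 : ℕ) + b) m * x ^ m * y ^ (n + 1 - m) with hP
  have s1 : ∑ m ∈ range (n + 1), ((m + 1 : ℕ) : ℝ) * P (m + 1) =
      ∑ m ∈ range (n + 2), (m : ℝ) * P m := by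
    rw [Finset.sum_range_succ' _ (n + 1)]; simp
  have s2 : ∑ m ∈ range (n + 1), ((n + 1 - m : ℕ) : ℝ) * P m =
      ∑ m ∈ range (n + 2), ((n + 1 - m : ℕ) : ℝ) * P m := by
    rw [Finset.sum_range_succ _ (n + 1)]; simp
  change -2 * ∑ m ∈ range (n + 1), ((m + 1 : ℕ) : ℝ) * P (m + 1) +
    -2 * ∑ m ∈ range (n + 1), ((n + 1 - m : ℕ) : ℝ) * P m = -2 * (n + 1) * ∑ m ∈ range (n + 2), P m
  rw [s1, s2, ← mul_add, ← Finset.sum_add_distrib, mul_assoc, Finset.mul_sum _ _ ((n : ℝ) + 1)]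
  congr 1
  refine Finset.sum_congr rfl fun m hm => ?_
  have : m ≤ n + 1 := by have := Finset.mem_range.1 hm; omega
  push_cast [Nat.cast_sub this]
  ring

lemma abs_genBinom_le_pow_div_factorial (b : ℝ) {n m : ℕ} (hn : 1 ≤ n) (hm : m ≤ n) :
    |genBinom (n + b) m| ≤ ((1 + |b|) * n) ^ m / m.factorial := by
  unfold genBinom
  rw [abs_div, Nat.abs_cast, Finset.abs_prod]
  gcongr
  calc ∏ i ∈ range m, |(n : ℝ) + b - i| ≤ ∏ _i ∈ range m, ((1 + |b|) * n) := by
        refine Finset.prod_le_prod (fun _ _ => abs_nonneg _) fun i hi => ?_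
        have hi' : (i : ℝ) ≤ n := by
          exact_mod_cast ((Finset.mem_range.1 hi).le.trans hm)
        have hn' : (1 : ℝ) ≤ n := by exact_mod_cast hn
        have hb := abs_nonneg b
        have hi0 : (0 : ℝ) ≤ i := Nat.cast_nonneg i
        rw [abs_le]
        constructor <;> nlinarith [neg_abs_le b, le_abs_self b]
    _ = _ := by simp

lemma abs_one_add_le_exp (x : ℝ) : |1 + x| ≤ Real.exp (x + 2 * x ^ 2) := by
  rcases le_or_gt (-1) x with h | h
  · rw [abs_of_nonneg (by linarith)]
    calc 1 + x = x + 1 := by ring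
      _ ≤ Real.exp x := Real.add_one_le_exp x
      _ ≤ _ := Real.exp_le_exp.2 (by nlinarith [sq_nonneg x])
  · rw [abs_of_nonpos (by linarith)]
    calc -(1 + x) ≤ -x + 1 := by linarith
      _ ≤ Real.exp (-x) := Real.add_one_le_exp (-x)
      _ ≤ _ := Real.exp_le_exp.2 (by nlinarith)

lemma abs_genBinom_le_choose_mul_exp (a : ℝ) (m k : ℕ) :
    |genBinom ((m + k : ℕ) + a) k| ≤ ((m + k).choose m : ℝ) *
      Real.exp (a * ((harmonic (m + k) : ℝ) - harmonic m) +
        4 * a ^ 2 * (1 - 1 / ((m + k : ℕ) + 1 : ℝ))) := by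
  induction k with
  | zero =>
    simp only [genBinom, add_zero, range_zero, prod_empty, Nat.factorial_zero, Nat.cast_one,
      div_one, abs_one, Nat.choose_self, one_mul, sub_self, mul_zero, zero_add]
    refine Real.one_le_exp (mul_nonneg (by positivity) ?_)
    rw [sub_nonneg]
    exact div_le_one_of_le₀ (by linarith [Nat.cast_nonneg (α := ℝ) m]) (by positivity)
  | succ k ih =>
    set j : ℝ := ((m + k : ℕ) : ℝ) + 1 with hj
    have hj1 : 1 ≤ j := by rw [hj]; linarith [Nat.cast_nonneg (α := ℝ) (m + k)]
    have hj0 : 0 < j := by linarith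
    have e1 : genBinom ((m + (k + 1) : ℕ) + a) (k + 1) =
        (j / (k + 1)) * (1 + a / j) * genBinom ((m + k : ℕ) + a) k := by
      unfold genBinom
      rw [Finset.prod_range_succ', Nat.factorial_succ]
      have h2 : ∀ i ∈ range k, (((m + (k + 1) : ℕ) : ℝ) + a - ((i + 1 : ℕ) : ℝ)) =
          ((m + k : ℕ) : ℝ) + a - i := by
        intro i _; push_cast; ring
      rw [Finset.prod_congr rfl h2]
      have h3 : ((m + (k + 1) : ℕ) : ℝ) = j := by rw [hj]; push_cast; ring
      rw [h3]
      have h4 : ((k.factorial : ℕ) : ℝ) ≠ 0 := by exact_mod_cast k.factorial_ne_zero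
      have h5 : (k : ℝ) + 1 ≠ 0 := by positivity
      push_cast
      field_simp
      ring
    have e2 : ((m + (k + 1)).choose m : ℝ) = (j / (k + 1)) * ((m + k).choose m : ℝ) := by
      have h := Nat.add_one_mul_choose_eq (m + k) k
      have h6 : (m + k).choose m = (m + k).choose k := by
        rw [← Nat.choose_symm_add]
      have h7 : (m + (k + 1)).choose m = (m + k + 1).choose (k + 1) := by
        rw [Nat.choose_symm_add]; rfl
      rw [h6, h7]
      have h5 : (k : ℝ) + 1 ≠ 0 := by positivity
      have h8 : j * ((m + k).choose k : ℝ) = ((m + k + 1).choose (k + 1) : ℝ) * (k + 1) := by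
        rw [hj]; exact_mod_cast h
      field_simp
      linarith
    have e3 : (harmonic (m + (k + 1)) : ℝ) = harmonic (m + k) + 1 / j := by
      rw [← add_assoc, harmonic_succ]
      push_cast [hj]
      ring
    have e4 : |1 + a / j| ≤ Real.exp (a * (1 / j) + 4 * a ^ 2 * (1 / j - 1 / (j + 1))) := by
      refine (abs_one_add_le_exp _).trans (Real.exp_le_exp.2 ?_)
      have : 2 * (a / j) ^ 2 ≤ 4 * a ^ 2 * (1 / j - 1 / (j + 1)) := by
        have h9 : 1 / j - 1 / (j + 1) = 1 / (j * (j + 1)) := by field_simp; ring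
        have h10 : 1 / j ^ 2 ≤ 2 * (1 / (j * (j + 1))) := by
          rw [div_le_iff₀ (by positivity)]
          field_simp
          nlinarith
        rw [h9]
        calc 2 * (a / j) ^ 2 = 2 * a ^ 2 * (1 / j ^ 2) := by rw [div_pow]; ring
          _ ≤ 2 * a ^ 2 * (2 * (1 / (j * (j + 1)))) := by gcongr
          _ = _ := by ring
      have h11 : a / j = a * (1 / j) := by ring
      linarith
    have e5 : ((m + (k + 1) : ℕ) : ℝ) + 1 = j + 1 := by rw [hj]; push_cast; ring
    rw [e1, e2, e3, e5, abs_mul, abs_mul, abs_of_nonneg (show (0 : ℝ) ≤ j / (k + 1) by positivity)]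
    calc j / (k + 1) * |1 + a / j| * |genBinom ((m + k : ℕ) + a) k|
        ≤ j / (k + 1) * Real.exp (a * (1 / j) + 4 * a ^ 2 * (1 / j - 1 / (j + 1))) *
          (((m + k).choose m : ℝ) *
            Real.exp (a * ((harmonic (m + k) : ℝ) - harmonic m) + 4 * a ^ 2 * (1 - 1 / j))) := by
          gcongr
      _ = _ := by
        rw [show a * ((harmonic (m + k) : ℝ) + 1 / j - harmonic m) +
            4 * a ^ 2 * (1 - 1 / (j + 1)) =
            (a * (1 / j) + 4 * a ^ 2 * (1 / j - 1 / (j + 1))) +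
            (a * ((harmonic (m + k) : ℝ) - harmonic m) + 4 * a ^ 2 * (1 - 1 / j)) by ring,
          Real.exp_add (a * (1 / j) + 4 * a ^ 2 * (1 / j - 1 / (j + 1)))]
        ring

lemma harmonic_le_self (m : ℕ) : (harmonic m : ℝ) ≤ m := by
  induction m with
  | zero => simp
  | succ m ih =>
    rw [harmonic_succ]
    push_cast at ih ⊢
    have : ((m : ℝ) + 1)⁻¹ ≤ 1 := inv_le_one_of_one_le₀ (by linarith [Nat.cast_nonneg (α := ℝ) m])
    linarith

lemma harmonic_cast_nonneg (m : ℕ) : (0 : ℝ) ≤ harmonic m := by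
  unfold harmonic
  push_cast
  positivity

lemma abs_genBinom_compl_le (a : ℝ) : ∃ C D : ℝ, 0 < C ∧ 0 < D ∧ ∀ n m : ℕ, 1 ≤ n → m ≤ n →
    |genBinom (n + a) (n - m)| ≤ C * (D * n) ^ m * (n : ℝ) ^ a := by
  refine ⟨Real.exp (|a| + 4 * a ^ 2), Real.exp |a|, Real.exp_pos _, Real.exp_pos _, ?_⟩
  intro n m hn hm
  obtain ⟨k, rfl⟩ : ∃ k, n = m + k := ⟨n - m, by omega⟩
  rw [Nat.add_sub_cancel_left]
  refine (abs_genBinom_le_choose_mul_exp a m k).trans ?_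
  set n := m + k with hn'
  have hn0 : (0 : ℝ) < n := by exact_mod_cast hn
  have h1 : ((n.choose m : ℕ) : ℝ) ≤ (n : ℝ) ^ m := by exact_mod_cast Nat.choose_le_pow n m
  have h2 : a * ((harmonic n : ℝ) - harmonic m) + 4 * a ^ 2 * (1 - 1 / ((n : ℝ) + 1)) ≤
      (|a| + 4 * a ^ 2) + (m * |a| + Real.log n * a) := by
    have h3 : 4 * a ^ 2 * (1 - 1 / ((n : ℝ) + 1)) ≤ 4 * a ^ 2 := by
      have : 0 ≤ 1 / ((n : ℝ) + 1) := by positivity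
      nlinarith [sq_nonneg a]
    have h4 : (harmonic n : ℝ) ≤ 1 + Real.log n := by exact_mod_cast harmonic_le_one_add_log n
    have h5 : Real.log n ≤ (harmonic n : ℝ) := by
      have h := log_add_one_le_harmonic n
      have h' : Real.log n ≤ Real.log (n + 1 : ℕ) :=
        Real.log_le_log hn0 (by push_cast; linarith)
      push_cast at h h'
      linarith
    have h6 := harmonic_le_self m
    have h7 := harmonic_cast_nonneg m
    rcases le_or_gt 0 a with ha | ha
    · rw [abs_of_nonneg ha]
      have : (0 : ℝ) ≤ m := Nat.cast_nonneg m
      nlinarith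
    · rw [abs_of_neg ha]
      nlinarith
  calc ((n.choose m : ℕ) : ℝ) * Real.exp (a * ((harmonic n : ℝ) - harmonic m) +
        4 * a ^ 2 * (1 - 1 / ((n : ℝ) + 1)))
      ≤ (n : ℝ) ^ m * Real.exp ((|a| + 4 * a ^ 2) + (m * |a| + Real.log n * a)) := by gcongr
    _ = _ := by
      rw [Real.exp_add, Real.exp_add (m * |a|), Real.exp_nat_mul, Real.rpow_def_of_pos hn0]
      ring

lemma exists_abs_jacobiP_le_near_one (a b K : ℝ) (hK : 0 ≤ K) :
    ∃ C : ℝ, 0 < C ∧ ∀ n : ℕ, 1 ≤ n → ∀ t : ℝ, -1 ≤ t → t ≤ 1 → 1 - t ≤ K / (n : ℝ) ^ 2 →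
      |jacobiP n a b t| ≤ C * (n : ℝ) ^ a := by
  obtain ⟨C, D, hC, hD, h⟩ := abs_genBinom_compl_le a
  refine ⟨C * Real.exp (D * (1 + |b|) * K), by positivity, ?_⟩
  intro n hn t ht1 ht2 htK
  have hn0 : (0 : ℝ) < n := by exact_mod_cast hn
  unfold jacobiP
  calc |∑ m ∈ range (n + 1), genBinom (n + a) (n - m) * genBinom (n + b) m *
          ((t - 1) / 2) ^ m * ((t + 1) / 2) ^ (n - m)|
      ≤ ∑ m ∈ range (n + 1), C * (n : ℝ) ^ a * ((D * (1 + |b|) * K) ^ m / m.factorial) := by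
        refine (Finset.abs_sum_le_sum_abs _ _).trans (Finset.sum_le_sum fun m hm => ?_)
        have hm' : m ≤ n := by have := Finset.mem_range.1 hm; omega
        have h1 := h n m hn hm'
        have h2 := abs_genBinom_le_pow_div_factorial b hn hm'
        have h3 : |((t - 1) / 2) ^ m| ≤ (K / (n : ℝ) ^ 2) ^ m := by
          rw [abs_pow]
          gcongr
          rw [abs_le]; constructor <;> linarith
        have h4 : |((t + 1) / 2) ^ (n - m)| ≤ 1 := by
          rw [abs_pow]
          refine pow_le_one₀ (abs_nonneg _) ?_
          rw [abs_le]; constructor <;> linarith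
        rw [abs_mul, abs_mul, abs_mul]
        calc _ ≤ (C * (D * n) ^ m * (n : ℝ) ^ a) * (((1 + |b|) * n) ^ m / m.factorial) *
              (K / (n : ℝ) ^ 2) ^ m * 1 := by gcongr
          _ = _ := by
            have e : (D * (1 + |b|) * K) ^ m =
                (D * n) ^ m * ((1 + |b|) * n) ^ m * (K / (n : ℝ) ^ 2) ^ m := by
              rw [← mul_pow, ← mul_pow]
              congr 1
              field_simp
            rw [e]; ring
    _ = C * (n : ℝ) ^ a * ∑ m ∈ range (n + 1), (D * (1 + |b|) * K) ^ m / m.factorial := by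
        rw [Finset.mul_sum]
    _ ≤ C * (n : ℝ) ^ a * Real.exp (D * (1 + |b|) * K) := by
        gcongr
        exact Real.sum_le_exp_of_nonneg (by positivity) _
    _ = _ := by ring

/-- A Sonin-type energy for the pair `P_{n+1}^{(a,b)}`, `P_n^{(a+1,b+1)}`. -/
noncomputable def jacobiEnergy (n : ℕ) (a b t : ℝ) : ℝ :=
  ((1 - t) ^ (a + 1 / 2) * (1 + t) ^ (b + 1 / 2)) *
    ((n + 1) * jacobiP (n + 1) a b t ^ 2 +
      (n + a + b + 2) / 4 * (1 - t ^ 2) * jacobiP n (a + 1) (b + 1) t ^ 2 +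
      (b - a - (a + b + 1) * t) / 2 * (jacobiP (n + 1) a b t * jacobiP n (a + 1) (b + 1) t))

lemma hasDerivAt_jacobiEnergy (n : ℕ) (a b : ℝ) {t : ℝ} (h1 : -1 < t) (h2 : t < 1) :
    HasDerivAt (jacobiEnergy n a b)
      (((1 - t) ^ (a + 1 / 2) * (1 + t) ^ (b + 1 / 2)) / (1 - t ^ 2) *
        (((b - a) * t - (a + b + 1)) / 2 *
          (jacobiP (n + 1) a b t * jacobiP n (a + 1) (b + 1) t))) t := by
  have hp := hasDerivAt_jacobiP_succ n a b t
  obtain ⟨D, hq, hD⟩ := deriv_jacobiP_identity n a b t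
  have l1 : HasDerivAt (fun t : ℝ => 1 - t) (-1) t := by
    simpa using (hasDerivAt_id t).const_sub 1
  have l2 : HasDerivAt (fun t : ℝ => 1 + t) 1 t := by
    simpa using (hasDerivAt_id t).const_add 1
  have l3 : HasDerivAt (fun t : ℝ => 1 - t ^ 2) (-(2 * t)) t := by
    simpa using (hasDerivAt_pow 2 t).const_sub 1
  have l4 : HasDerivAt (fun t : ℝ => (b - a - (a + b + 1) * t) / 2) (-(a + b + 1) / 2) t := by
    simpa using (((hasDerivAt_id t).const_mul (a + b + 1)).const_sub (b - a)).div_const 2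
  have w1 := l1.rpow_const (p := a + 1 / 2) (Or.inl (by linarith))
  have w2 := l2.rpow_const (p := b + 1 / 2) (Or.inl (by linarith))
  have h := (w1.fun_mul w2).fun_mul ((((hp.fun_pow 2).const_mul ((n : ℝ) + 1)).fun_add
    ((l3.const_mul ((n + a + b + 2) / 4)).fun_mul (hq.fun_pow 2))).fun_add
      (l4.fun_mul (hp.fun_mul hq)))
  refine HasDerivAt.congr_deriv (f := jacobiEnergy n a b) h ?_
  have p1 : 0 < 1 - t := by linarith
  have p2 : 0 < 1 + t := by linarith
  have r1 : (1 - t) ^ (a + 1 / 2 - 1) = (1 - t) ^ (a + 1 / 2) / (1 - t) := by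
    rw [Real.rpow_sub_one p1.ne']
  have r2 : (1 + t) ^ (b + 1 / 2 - 1) = (1 + t) ^ (b + 1 / 2) / (1 + t) := by
    rw [Real.rpow_sub_one p2.ne']
  rw [r1, r2]
  have hs : 1 - t ^ 2 = (1 - t) * (1 + t) := by ring
  have hD' : D = (-2 * (n + 1) * jacobiP (n + 1) a b t -
      (b - a - (a + b + 2) * t) * jacobiP n (a + 1) (b + 1) t) / ((1 - t) * (1 + t)) := by
    rw [eq_div_iff (by positivity), ← hs]; linarith
  rw [hD', hs]
  generalize (1 - t) ^ (a + 1 / 2) = U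
  generalize (1 + t) ^ (b + 1 / 2) = V
  generalize jacobiP (n + 1) a b t = p
  generalize jacobiP n (a + 1) (b + 1) t = q
  have p1' := p1.ne'
  have p2' := p2.ne'
  field_simp
  ring

lemma rpow_le_of_comparable {x y c : ℝ} (e : ℝ) (hx : 0 < x) (hy : 0 < y) (hc : 1 ≤ c)
    (hxy : x ≤ c * y) (hyx : y ≤ c * x) : x ^ e ≤ c ^ |e| * y ^ e := by
  have hc0 : 0 < c := by linarith
  rcases le_or_gt 0 e with he | he
  · rw [abs_of_nonneg he, ← Real.mul_rpow hc0.le hy.le]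
    exact Real.rpow_le_rpow hx.le hxy he
  · rw [abs_of_neg he, Real.rpow_neg hc0.le, ← Real.inv_rpow hc0.le,
      ← Real.mul_rpow (by positivity) hy.le]
    refine Real.rpow_le_rpow_of_nonpos (by positivity) ?_ he.le
    rw [inv_mul_le_iff₀ hc0]
    exact hyx

lemma abs_mul_le_of_energy {N L s p q : ℝ} (hN : 0 < N) (hL : N / 4 ≤ L) :
    N * s * |p * q| ≤ 2 * (N * p ^ 2 + L / 4 * s ^ 2 * q ^ 2) := by
  have h1 : N * p ^ 2 + N / 4 / 4 * s ^ 2 * q ^ 2 ≤ N * p ^ 2 + L / 4 * s ^ 2 * q ^ 2 := by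
    gcongr
  rw [abs_mul]
  have h2 : 0 ≤ N * (|p| - s * |q| / 4) ^ 2 := by positivity
  rw [← sq_abs p, ← sq_abs q] at h1 ⊢
  nlinarith

lemma energy_inequalities {N L M r W p q t k k' G : ℝ} (hN0 : 0 < N) (hM0 : 1 ≤ M)
    (hL1 : N / 4 ≤ L) (hL2 : L ≤ M * N) (hr0 : 0 < r) (hr2 : r ^ 2 = 1 - t) (ht0 : 0 ≤ t)
    (ht1 : t ≤ 1) (hW0 : 0 < W) (hk : |k| ≤ M / 2) (hk' : |k'| ≤ M / 2) (hM1 : 2 * M ≤ N * r)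
    (hG : G = W * (N * p ^ 2 + L / 4 * (1 - t ^ 2) * q ^ 2 + k * (p * q))) :
    W * (N * p ^ 2) ≤ 2 * G ∧
      |G| ≤ 2 * W * (N * p ^ 2 + M * N * (1 - t) * q ^ 2) ∧
      |W / (1 - t ^ 2) * (k' * (p * q))| ≤ 2 * M / (N * r ^ 3) * G := by
  have hL0 : 0 < L := by linarith
  have hsum : 1 - t ^ 2 = r ^ 2 * (1 + t) := by rw [hr2]; ring
  obtain ⟨E, hE⟩ : ∃ E, E = N * p ^ 2 + L / 4 * (1 - t ^ 2) * q ^ 2 := ⟨_, rfl⟩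
  rw [← hE] at hG
  have hE0 : N * r * |p * q| ≤ 2 * E := by
    refine (abs_mul_le_of_energy (s := r) hN0 hL1).trans ?_
    rw [hE, hsum]
    have : L / 4 * r ^ 2 * q ^ 2 * 1 ≤ L / 4 * r ^ 2 * q ^ 2 * (1 + t) := by
      gcongr; linarith
    linarith
  have hEp : N * p ^ 2 ≤ E := by
    have : 0 ≤ L / 4 * (1 - t ^ 2) * q ^ 2 := by rw [hsum]; positivity
    rw [hE]; linarith
  have hEnn : 0 ≤ E := le_trans (by positivity) hEp
  have hpq : |p * q| ≤ 2 * E / (N * r) := by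
    rw [le_div_iff₀ (by positivity)]; linarith
  have hcross : |k * (p * q)| ≤ E / 2 := by
    rw [abs_mul]
    calc _ ≤ M / 2 * (2 * E / (N * r)) := by gcongr
      _ = M * E / (N * r) := by ring
      _ ≤ E / 2 := by
        rw [div_le_iff₀ (by positivity)]
        have := mul_le_mul_of_nonneg_left hM1 hEnn
        linarith
  obtain ⟨hc1, hc2⟩ := abs_le.1 hcross
  have hEG : W * E ≤ 2 * G := by
    have := mul_le_mul_of_nonneg_left (show E ≤ 2 * (E + k * (p * q)) by linarith) hW0.le
    rw [hG]; linarith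
  refine ⟨?_, ?_, ?_⟩
  · exact (mul_le_mul_of_nonneg_left hEp hW0.le).trans hEG
  · have hE2 : E ≤ N * p ^ 2 + M * N * (1 - t) * q ^ 2 := by
      rw [hE, hsum, ← hr2]
      have : L / 4 * (r ^ 2 * (1 + t)) * q ^ 2 ≤ (M * N) / 4 * (r ^ 2 * 2) * q ^ 2 := by
        gcongr; linarith
      have h3 : 0 ≤ M * N * r ^ 2 * q ^ 2 := by positivity
      linarith
    rw [hG, abs_mul, abs_of_pos hW0, mul_comm 2 W, mul_assoc]
    refine mul_le_mul_of_nonneg_left ?_ hW0.le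
    rw [abs_le]; constructor <;> linarith
  · rw [abs_mul, abs_mul, abs_of_nonneg (show 0 ≤ W / (1 - t ^ 2) by rw [hsum]; positivity)]
    calc W / (1 - t ^ 2) * (|k'| * |p * q|)
        ≤ W / r ^ 2 * (M / 2 * (2 * E / (N * r))) := by
          gcongr
          rw [hsum]
          exact le_mul_of_one_le_right (sq_nonneg r) (by linarith)
      _ = M / (N * r ^ 3) * (W * E) := by field_simp
      _ ≤ M / (N * r ^ 3) * (2 * G) := by gcongr
      _ = _ := by ring

/-- In the oscillatory range the energy is comparable to its diagonal part, and is almost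
monotone. -/
lemma exists_jacobiEnergy_bounds (a b : ℝ) : ∃ M : ℝ, 1 ≤ M ∧ ∀ n : ℕ, M ≤ n → ∀ t : ℝ, 0 ≤ t →
    t < 1 → 2 * M ≤ (n + 1) * √(1 - t) →
      ((1 - t) ^ (a + 1 / 2) * (1 + t) ^ (b + 1 / 2)) * ((n + 1) * jacobiP (n + 1) a b t ^ 2) ≤
        2 * jacobiEnergy n a b t ∧
      |jacobiEnergy n a b t| ≤ 2 * ((1 - t) ^ (a + 1 / 2) * (1 + t) ^ (b + 1 / 2)) *
        ((n + 1) * jacobiP (n + 1) a b t ^ 2 +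
          M * (n + 1) * (1 - t) * jacobiP n (a + 1) (b + 1) t ^ 2) ∧
      |((1 - t) ^ (a + 1 / 2) * (1 + t) ^ (b + 1 / 2)) / (1 - t ^ 2) *
        (((b - a) * t - (a + b + 1)) / 2 *
          (jacobiP (n + 1) a b t * jacobiP n (a + 1) (b + 1) t))| ≤
        2 * M / ((n + 1) * √(1 - t) ^ 3) * jacobiEnergy n a b t := by
  obtain ⟨M, hM⟩ : ∃ M : ℝ, M = 2 * (|a| + |b| + 2) := ⟨_, rfl⟩
  have ha := abs_nonneg a
  have hb := abs_nonneg b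
  have ha1 := neg_abs_le a
  have ha2 := le_abs_self a
  have hb1 := neg_abs_le b
  have hb2 := le_abs_self b
  refine ⟨M, by linarith, ?_⟩
  intro n hn t ht0 ht1 hM1
  have hs : 0 < 1 - t := by linarith
  obtain ⟨hat1, hat2⟩ : -|a| ≤ a * t ∧ a * t ≤ |a| := by
    rw [← abs_le, abs_mul, abs_of_nonneg ht0]
    exact mul_le_of_le_one_right ha ht1.le
  obtain ⟨hbt1, hbt2⟩ : -|b| ≤ b * t ∧ b * t ≤ |b| := by
    rw [← abs_le, abs_mul, abs_of_nonneg ht0]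
    exact mul_le_of_le_one_right hb ht1.le
  have hn0 : (0 : ℝ) ≤ n := Nat.cast_nonneg n
  have hMN : 4 * ((n : ℝ) + 1) ≤ M * (n + 1) := by gcongr; linarith
  refine energy_inequalities (L := n + a + b + 2) (k := (b - a - (a + b + 1) * t) / 2)
    (by positivity) (by linarith) (by linarith) (by linarith) (Real.sqrt_pos.2 hs)
    (Real.sq_sqrt hs.le) ht0 ht1.le (by positivity) ?_ ?_ hM1 rfl
  · rw [abs_le]
    constructor <;> linarith
  · rw [abs_le]
    constructor <;> linarith

lemma jacobiEnergy_le_mul_exp (a b : ℝ) : ∃ M : ℝ, 1 ≤ M ∧ ∀ n : ℕ, M ≤ n → ∀ t t₀ : ℝ, 0 ≤ t →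
    t ≤ t₀ → t₀ < 1 → 2 * M ≤ (n + 1) * √(1 - t₀) →
      ((1 - t) ^ (a + 1 / 2) * (1 + t) ^ (b + 1 / 2)) * ((n + 1) * jacobiP (n + 1) a b t ^ 2) ≤
        4 * Real.exp 2 * (((1 - t₀) ^ (a + 1 / 2) * (1 + t₀) ^ (b + 1 / 2)) *
        ((n + 1) * jacobiP (n + 1) a b t₀ ^ 2 +
          M * (n + 1) * (1 - t₀) * jacobiP n (a + 1) (b + 1) t₀ ^ 2)) := by
  obtain ⟨M, hM, h⟩ := exists_jacobiEnergy_bounds a b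
  refine ⟨M, hM, fun n hn t t₀ ht htt ht₀ hMt => ?_⟩
  have hN0 : (0 : ℝ) < n + 1 := by positivity
  set c : ℝ := 4 * M / (n + 1) with hc
  have hc0 : 0 < c := by positivity
  have hmono : MonotoneOn (fun u => Real.exp (c * (√(1 - u))⁻¹) * jacobiEnergy n a b u)
      (Set.Icc 0 t₀) := by
    have hder : ∀ u ∈ Set.Icc 0 t₀,
        HasDerivAt (fun u => Real.exp (c * (√(1 - u))⁻¹) * jacobiEnergy n a b u)
        (Real.exp (c * (√(1 - u))⁻¹) * (c * (-(-1 / (2 * √(1 - u))) / √(1 - u) ^ 2)) *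
          jacobiEnergy n a b u + Real.exp (c * (√(1 - u))⁻¹) *
          (((1 - u) ^ (a + 1 / 2) * (1 + u) ^ (b + 1 / 2)) / (1 - u ^ 2) *
        (((b - a) * u - (a + b + 1)) / 2 *
          (jacobiP (n + 1) a b u * jacobiP n (a + 1) (b + 1) u)))) u := by
      intro u hu
      have hu1 : 0 < 1 - u := by linarith [hu.2]
      have l1 : HasDerivAt (fun t : ℝ => 1 - t) (-1) u := by
        simpa using (hasDerivAt_id u).const_sub 1
      have l2 := ((l1.sqrt hu1.ne').fun_inv (Real.sqrt_pos.2 hu1).ne').const_mul c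
      exact l2.exp.fun_mul
        (hasDerivAt_jacobiEnergy n a b (by linarith [hu.1]) (by linarith))
    refine monotoneOn_of_deriv_nonneg (convex_Icc 0 t₀)
      (fun u hu => (hder u hu).continuousAt.continuousWithinAt)
      (fun u hu => (hder u (interior_subset hu)).differentiableAt.differentiableWithinAt) ?_
    intro u hu
    have hu' := interior_subset hu
    rw [(hder u hu').deriv]
    have hu1 : 0 < 1 - u := by linarith [hu'.2]
    have hr0 : 0 < √(1 - u) := Real.sqrt_pos.2 hu1
    have h1 := (h n hn u hu'.1 (by linarith) (hMt.trans (by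
      gcongr; exact hu'.2))).2.2
    have h2 := (abs_le.1 h1).1
    rw [mul_assoc, ← mul_add]
    refine mul_nonneg (Real.exp_pos _).le ?_
    have h3 : c * (-(-1 / (2 * √(1 - u))) / √(1 - u) ^ 2) = 2 * M / ((n + 1) * √(1 - u) ^ 3) := by
      rw [hc]; field_simp; ring
    rw [h3]
    linarith
  have h1 := hmono (⟨ht, htt⟩ : t ∈ Set.Icc 0 t₀) ⟨ht.trans htt, le_rfl⟩ htt
  simp only at h1
  have hMt' : 2 * M ≤ (n + 1) * √(1 - t) := hMt.trans (by gcongr)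
  obtain ⟨h2, -, -⟩ := h n hn t ht (by linarith) hMt'
  obtain ⟨-, h3, -⟩ := h n hn t₀ (ht.trans htt) ht₀ hMt
  have hr0 : 0 < √(1 - t₀) := Real.sqrt_pos.2 (by linarith)
  have h4 : Real.exp (c * (√(1 - t₀))⁻¹) ≤ Real.exp 2 := by
    refine Real.exp_le_exp.2 ?_
    rw [hc, ← div_eq_mul_inv, div_div, div_le_iff₀ (by positivity)]
    linarith
  have h6 : (1 : ℝ) ≤ Real.exp (c * (√(1 - t))⁻¹) := Real.one_le_exp (by positivity)
  have hW : 0 ≤ (1 - t) ^ (a + 1 / 2) * (1 + t) ^ (b + 1 / 2) := by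
    have : 0 ≤ 1 - t := by linarith
    positivity
  have h7 : 0 ≤ jacobiEnergy n a b t := by
    have := mul_nonneg hW (show 0 ≤ ((n : ℝ) + 1) * jacobiP (n + 1) a b t ^ 2 by positivity)
    linarith
  calc _ ≤ 2 * jacobiEnergy n a b t := h2
    _ ≤ 2 * (Real.exp (c * (√(1 - t))⁻¹) * jacobiEnergy n a b t) := by nlinarith
    _ ≤ 2 * (Real.exp (c * (√(1 - t₀))⁻¹) * |jacobiEnergy n a b t₀|) := by
        refine mul_le_mul_of_nonneg_left (h1.trans ?_) (by norm_num)
        gcongr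
        exact le_abs_self _
    _ ≤ 2 * (Real.exp 2 * |jacobiEnergy n a b t₀|) := by gcongr
    _ ≤ 2 * (Real.exp 2 * (2 * ((1 - t₀) ^ (a + 1 / 2) * (1 + t₀) ^ (b + 1 / 2)) *
        ((n + 1) * jacobiP (n + 1) a b t₀ ^ 2 +
          M * (n + 1) * (1 - t₀) * jacobiP n (a + 1) (b + 1) t₀ ^ 2))) := by gcongr
    _ = _ := by ring

lemma sq_le_of_energy_bound {p X Z N R V c₃ c₄ c₅ E M C D : ℝ} (hX : 0 < X) (hN : 0 < N)
    (hR : 0 < R) (hc₃ : 0 < c₃) (hc₄ : 0 < c₄) (hc₅ : 0 < c₅) (hE : 0 < E)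
    (hV : 1 ≤ c₃ * V) (hYZ : 1 ≤ c₄ * (X ^ 2 * N * R) * Z ^ 2)
    (hkey : R * V * (N * p ^ 2) ≤ 4 * E * (c₅ / (X ^ 2 * N) * c₃ * (N * (C * X) ^ 2 +
      M * N * (2 * M / N) ^ 2 * (D * (X * N)) ^ 2))) :
    p ^ 2 ≤ c₄ * c₃ * (4 * E * (c₅ * c₃ * (C ^ 2 + 4 * M ^ 3 * D ^ 2))) * (X * Z) ^ 2 := by
  have h1 : R * (N * p ^ 2) ≤ c₃ * (4 * E * (c₅ * c₃ * (C ^ 2 + 4 * M ^ 3 * D ^ 2))) := by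
    calc R * (N * p ^ 2) ≤ R * (N * p ^ 2) * (c₃ * V) :=
          le_mul_of_one_le_right (by positivity) hV
      _ = c₃ * (R * V * (N * p ^ 2)) := by ring
      _ ≤ c₃ * (4 * E * (c₅ / (X ^ 2 * N) * c₃ * (N * (C * X) ^ 2 +
          M * N * (2 * M / N) ^ 2 * (D * (X * N)) ^ 2))) := by gcongr
      _ = _ := by field_simp; ring
  calc p ^ 2 ≤ p ^ 2 * (c₄ * (X ^ 2 * N * R) * Z ^ 2) :=
        le_mul_of_one_le_right (by positivity) hYZ
    _ = c₄ * (X * Z) ^ 2 * (R * (N * p ^ 2)) := by ring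
    _ ≤ c₄ * (X * Z) ^ 2 * (c₃ * (4 * E * (c₅ * c₃ * (C ^ 2 + 4 * M ^ 3 * D ^ 2)))) := by gcongr
    _ = _ := by ring

set_option maxHeartbeats 1000000 in
lemma exists_abs_jacobiP_le_eventually (a b : ℝ) : ∃ C : ℝ, 0 < C ∧ ∃ N₀ : ℕ, ∀ n : ℕ, N₀ ≤ n →
    ∀ t : ℝ, 0 ≤ t → t ≤ 1 →
      |jacobiP n a b t| ≤ C * (n : ℝ) ^ a * (1 + n * √(1 - t)) ^ (-a - 1 / 2) := by
  obtain ⟨M, hM, hE⟩ := jacobiEnergy_le_mul_exp a b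
  obtain ⟨C₁, hC₁, hn₁⟩ := exists_abs_jacobiP_le_near_one a b (4 * M ^ 2) (by positivity)
  obtain ⟨C₂, hC₂, hn₂⟩ := exists_abs_jacobiP_le_near_one (a + 1) (b + 1) (4 * M ^ 2) (by positivity)
  set c₁ : ℝ := (1 + 2 * M) ^ |-a - 1 / 2| with hc₁
  set c₂ : ℝ := 2 ^ |a + 1| with hc₂
  set c₃ : ℝ := 2 ^ |b + 1 / 2| with hc₃
  set c₄ : ℝ := 2 ^ |2 * a + 1| with hc₄
  set c₅ : ℝ := (2 * M) ^ (2 * a + 1) with hc₅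
  have hc₁0 : 0 < c₁ := by positivity
  have hc₂0 : 0 < c₂ := by positivity
  have hc₃0 : 0 < c₃ := by positivity
  have hc₄0 : 0 < c₄ := by positivity
  have hc₅0 : 0 < c₅ := by positivity
  set B : ℝ := c₄ * c₃ * (4 * Real.exp 2 * (c₅ * c₃ * (C₁ ^ 2 + 4 * M ^ 3 * (C₂ * c₂) ^ 2))) with hB
  have hB0 : 0 < B := by positivity
  refine ⟨C₁ * c₁ + √B, by positivity, ⌈2 * M⌉₊ + 2, ?_⟩
  intro n' hn' t ht0 ht1
  obtain ⟨n, rfl⟩ : ∃ n, n' = n + 1 := ⟨n' - 1, by omega⟩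
  have hnM : 2 * M ≤ n := by
    refine (Nat.le_ceil _).trans ?_
    exact_mod_cast (by omega : ⌈2 * M⌉₊ ≤ n)
  have hn1 : 1 ≤ n := by omega
  have hn0 : (1 : ℝ) ≤ n := by exact_mod_cast hn1
  have hNc : ((n + 1 : ℕ) : ℝ) = n + 1 := by push_cast; ring
  rw [hNc]
  set N : ℝ := n + 1 with hN
  have hN0 : 0 < N := by positivity
  set r := √(1 - t) with hr
  have hr0 : 0 ≤ r := Real.sqrt_nonneg _
  have hr2 : r ^ 2 = 1 - t := Real.sq_sqrt (by linarith)
  set Y := 1 + N * r with hY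
  have hY1 : 1 ≤ Y := by
    have : 0 ≤ N * r := by positivity
    linarith
  set X := N ^ a with hX
  have hX0 : 0 < X := by positivity
  set Z := Y ^ (-a - 1 / 2) with hZ
  have hZ0 : 0 < Z := by positivity
  rcases le_or_gt (N * r) (2 * M) with hnear | hfar
  · have h1 : 1 - t ≤ 4 * M ^ 2 / ((n + 1 : ℕ) : ℝ) ^ 2 := by
      rw [hNc, le_div_iff₀ (by positivity), ← hr2, ← mul_pow]
      calc (r * N) ^ 2 ≤ (2 * M) ^ 2 := pow_le_pow_left₀ (by positivity) (by linarith) 2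
        _ = _ := by ring
    have h2 := hn₁ (n + 1) (by omega) t (by linarith) ht1 h1
    rw [hNc] at h2
    have h3 : (1 : ℝ) ≤ c₁ * Z := by
      have := rpow_le_of_comparable (x := 1) (y := Y) (c := 1 + 2 * M) (-a - 1 / 2) one_pos
        (by linarith) (by linarith) (by nlinarith) (by linarith)
      rwa [Real.one_rpow] at this
    calc _ ≤ C₁ * X := h2
      _ ≤ C₁ * X * (c₁ * Z) := le_mul_of_one_le_right (by positivity) h3
      _ = (C₁ * c₁) * X * Z := by ring
      _ ≤ _ := by gcongr; linarith [Real.sqrt_nonneg B]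
  · obtain ⟨t₀, ht₀⟩ : ∃ t₀, t₀ = 1 - (2 * M / N) ^ 2 := ⟨_, rfl⟩
    have hx0 : 0 < 2 * M / N := by positivity
    have hxr : 2 * M / N ≤ r := by rw [div_le_iff₀ hN0]; linarith
    have hx1 : 2 * M / N ≤ 1 := by rw [div_le_iff₀ hN0]; linarith
    have h1t₀ : 1 - t₀ = (2 * M / N) ^ 2 := by rw [ht₀]; ring
    have ht₀0 : 0 ≤ t₀ := by rw [ht₀]; nlinarith
    have htt₀ : t ≤ t₀ := by
      have : (2 * M / N) ^ 2 ≤ r ^ 2 := by gcongr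
      linarith
    have ht₀1 : t₀ < 1 := by
      have : 0 < (2 * M / N) ^ 2 := by positivity
      linarith
    have hkey := hE n (by linarith) t t₀ ht0 htt₀ ht₀1 (by
      rw [h1t₀, Real.sqrt_sq hx0.le]; rw [← hN]; field_simp; rfl)
    have hr0' : 0 < r := hx0.trans_le hxr
    rw [← hN] at hkey
    set p := jacobiP (n + 1) a b t with hp
    set p₀ := jacobiP (n + 1) a b t₀ with hp₀
    set q₀ := jacobiP n (a + 1) (b + 1) t₀ with hq₀
    have hp₀' : p₀ ^ 2 ≤ (C₁ * X) ^ 2 := by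
      have := hn₁ (n + 1) (by omega) t₀ (by linarith) ht₀1.le (by
        rw [hNc, h1t₀, div_pow]; apply le_of_eq; ring)
      rw [hNc] at this
      rw [← sq_abs]; gcongr
    have hq₀' : q₀ ^ 2 ≤ (C₂ * c₂ * (X * N)) ^ 2 := by
      have h1 := hn₂ n hn1 t₀ (by linarith) ht₀1.le (by
        rw [h1t₀, div_pow, mul_pow, show (2 : ℝ) ^ 2 = 4 by norm_num]
        gcongr
        linarith)
      have h2 : (n : ℝ) ^ (a + 1) ≤ c₂ * (X * N) := by
        rw [hX, ← Real.rpow_add_one hN0.ne']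
        exact rpow_le_of_comparable _ (by linarith) hN0 (by norm_num) (by linarith) (by linarith)
      rw [← sq_abs]
      gcongr
      calc _ ≤ C₂ * (n : ℝ) ^ (a + 1) := h1
        _ ≤ C₂ * (c₂ * (X * N)) := by gcongr
        _ = _ := by ring
    have hN2 : N ^ (2 * a + 1) = X ^ 2 * N := by
      rw [Real.rpow_add_one hN0.ne', mul_comm 2 a, Real.rpow_mul hN0.le, hX, Real.rpow_two]
    have hsq : ∀ x : ℝ, 0 ≤ x → (x ^ 2) ^ (a + 1 / 2) = x ^ (2 * a + 1) := by
      intro x hx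
      rw [← Real.rpow_two, ← Real.rpow_mul hx]
      congr 1; ring
    have hW₀ : (1 - t₀) ^ (a + 1 / 2) = c₅ / (X ^ 2 * N) := by
      rw [h1t₀, hsq _ hx0.le, Real.div_rpow (by positivity) hN0.le, hN2]
    have hV₀ : (1 + t₀) ^ (b + 1 / 2) ≤ c₃ := by
      have := rpow_le_of_comparable (x := 1 + t₀) (y := 1) (c := 2) (b + 1 / 2) (by linarith)
        one_pos (by norm_num) (by linarith) (by linarith)
      rwa [Real.one_rpow, mul_one] at this
    have hV : 1 ≤ c₃ * (1 + t) ^ (b + 1 / 2) := by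
      have := rpow_le_of_comparable (y := 1 + t) (x := 1) (c := 2) (b + 1 / 2) one_pos
        (by linarith) (by norm_num) (by linarith) (by linarith)
      rwa [Real.one_rpow] at this
    have hR : (1 - t) ^ (a + 1 / 2) = r ^ (2 * a + 1) := by rw [← hr2, hsq _ hr0]
    set R := r ^ (2 * a + 1) with hR'
    have hR0 : 0 < R := by positivity
    rw [hR, hW₀] at hkey
    have hYZ : 1 ≤ c₄ * (X ^ 2 * N * R) * Z ^ 2 := by
      have h1 : Y ^ (2 * a + 1) ≤ c₄ * (N * r) ^ (2 * a + 1) :=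
        rpow_le_of_comparable _ (by linarith) (by positivity) (by norm_num) (by linarith)
          (by linarith)
      rw [Real.mul_rpow hN0.le hr0, hN2] at h1
      have h2 : Y ^ (2 * a + 1) * Z ^ 2 = 1 := by
        rw [hZ, ← Real.rpow_two, ← Real.rpow_mul (by linarith), ← Real.rpow_add (by linarith)]
        rw [show 2 * a + 1 + (-a - 1 / 2) * 2 = 0 by ring, Real.rpow_zero]
      calc 1 = Y ^ (2 * a + 1) * Z ^ 2 := h2.symm
        _ ≤ _ := by gcongr
    have hfin : p ^ 2 ≤ B * (X * Z) ^ 2 := by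
      refine sq_le_of_energy_bound hX0 hN0 hR0 hc₃0 hc₄0 hc₅0 (Real.exp_pos 2) hV hYZ
        (hkey.trans ?_)
      rw [h1t₀]
      gcongr
    have hlast : |p| ≤ √B * (X * Z) := by
      refine abs_le_of_sq_le_sq ?_ (by positivity)
      rw [mul_pow, Real.sq_sqrt hB0.le]
      exact hfin
    calc |p| ≤ √B * (X * Z) := hlast
      _ ≤ (C₁ * c₁ + √B) * (X * Z) := by gcongr; linarith [mul_pos hC₁ hc₁0]
      _ = _ := by ring

lemma exists_bound_of_eventually_bound {S : Set ℝ} (hS : IsCompact S) (f w : ℕ → ℝ → ℝ)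
    (hf : ∀ n, Continuous (f n)) (hw : ∀ n, 1 ≤ n → ContinuousOn (w n) S)
    (hw0 : ∀ n, 1 ≤ n → ∀ x ∈ S, 0 < w n x)
    (h : ∃ C : ℝ, 0 < C ∧ ∃ N₀ : ℕ, ∀ n, 1 ≤ n → N₀ ≤ n → ∀ x ∈ S, |f n x| ≤ C * w n x) :
    ∃ C : ℝ, 0 < C ∧ ∀ n, 1 ≤ n → ∀ x ∈ S, |f n x| ≤ C * w n x := by
  obtain ⟨C, hC, N₀, hC'⟩ := h
  have hD : ∀ n, ∃ D : ℝ, 0 ≤ D ∧ (1 ≤ n → ∀ x ∈ S, |f n x| ≤ D * w n x) := by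
    intro n
    rcases Nat.eq_zero_or_pos n with h0 | h1
    · exact ⟨0, le_rfl, fun h => by omega⟩
    · obtain ⟨D, hD⟩ := hS.exists_bound_of_continuousOn (f := fun x => f n x / w n x)
        ((hf n).continuousOn.div (hw n h1) fun x hx => (hw0 n h1 x hx).ne')
      refine ⟨|D|, abs_nonneg _, fun _ x hx => ?_⟩
      have h2 := hD x hx
      rw [Real.norm_eq_abs, abs_div, abs_of_pos (hw0 n h1 x hx),
        div_le_iff₀ (hw0 n h1 x hx)] at h2
      exact h2.trans (mul_le_mul_of_nonneg_right (le_abs_self D) (hw0 n h1 x hx).le)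
  choose D hD0 hD using hD
  refine ⟨C + ∑ n ∈ range N₀, D n, add_pos_of_pos_of_nonneg hC (sum_nonneg fun i _ => hD0 i),
    fun n hn x hx => ?_⟩
  have hwx := hw0 n hn x hx
  rcases le_or_gt N₀ n with h1 | h1
  · refine (hC' n hn h1 x hx).trans (mul_le_mul_of_nonneg_right ?_ hwx.le)
    linarith [sum_nonneg fun i (_ : i ∈ range N₀) => hD0 i]
  · refine (hD n hn x hx).trans (mul_le_mul_of_nonneg_right ?_ hwx.le)
    linarith [single_le_sum (fun i _ => hD0 i) (mem_range.2 h1)]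

lemma continuous_one_add_mul_sqrt_rpow (n : ℕ) (e : ℝ) :
    Continuous fun t : ℝ => (1 + n * √(1 - |t|)) ^ e := by
  refine Continuous.rpow_const (by fun_prop) fun t => Or.inl ?_
  positivity

lemma exists_abs_jacobiP_le {α β : ℝ} (hαβ : β ≤ α) : ∃ C : ℝ, 0 < C ∧ ∀ n : ℕ, 1 ≤ n →
    ∀ t ∈ Set.Icc (-1 : ℝ) 1,
      |jacobiP n α β t| ≤ C * ((n : ℝ) ^ α * (1 + n * √(1 - |t|)) ^ (-α - 1 / 2)) := by
  refine exists_bound_of_eventually_bound isCompact_Icc (fun n => jacobiP n α β)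
    (fun n t => (n : ℝ) ^ α * (1 + n * √(1 - |t|)) ^ (-α - 1 / 2))
    (fun n => continuous_jacobiP n α β)
    (fun n _ => (continuous_const.mul (continuous_one_add_mul_sqrt_rpow n _)).continuousOn)
    (fun n hn t _ => ?_) ?_
  · have : (0 : ℝ) < n := by exact_mod_cast hn
    positivity
  obtain ⟨C₁, hC₁, N₁, h₁⟩ := exists_abs_jacobiP_le_eventually α β
  obtain ⟨C₂, hC₂, N₂, h₂⟩ := exists_abs_jacobiP_le_eventually β α
  refine ⟨C₁ + C₂ * 3 ^ (α - β), by positivity, max N₁ N₂, fun n hn hN t ht => ?_⟩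
  have hn1 : (1 : ℝ) ≤ n := by exact_mod_cast hn
  have hY : 0 < 1 + n * √(1 - |t|) := by positivity
  rcases le_or_gt 0 t with h0 | h0
  · have := h₁ n (by omega) t h0 ht.2
    rw [abs_of_nonneg h0]
    rw [abs_of_nonneg h0] at hY
    calc _ ≤ _ := this
      _ = C₁ * ((n : ℝ) ^ α * (1 + n * √(1 - t)) ^ (-α - 1 / 2)) := by ring
      _ ≤ _ := by
        gcongr
        linarith [show 0 < C₂ * 3 ^ (α - β) by positivity]
  · have h3 := h₂ n (by omega) (-t) (by linarith) (by linarith [ht.1])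
    have h4 : |jacobiP n α β t| = |jacobiP n β α (-t)| := by
      rw [jacobiP_neg, abs_mul, abs_pow, abs_neg, abs_one, one_pow, one_mul]
    rw [h4]
    rw [abs_of_neg h0] at hY ⊢
    have h5 : √(1 - -t) ≤ 1 := Real.sqrt_le_one.2 (by linarith)
    set Y := 1 + n * √(1 - -t)
    have h6 : Y ≤ 3 * n := by
      have : n * √(1 - -t) ≤ n * 1 := by gcongr
      simp only [Y]; linarith
    calc _ ≤ _ := h3
      _ = C₂ * ((n : ℝ) ^ β * (Y ^ (-α - 1 / 2) * Y ^ (α - β))) := by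
        rw [← Real.rpow_add hY, mul_assoc]
        congr 3
        ring
      _ ≤ C₂ * ((n : ℝ) ^ β * (Y ^ (-α - 1 / 2) * (3 * n) ^ (α - β))) := by
        gcongr
      _ = (C₂ * 3 ^ (α - β)) * ((n : ℝ) ^ α * Y ^ (-α - 1 / 2)) := by
        rw [Real.mul_rpow (by norm_num) (by linarith),
          show (n : ℝ) ^ α = (n : ℝ) ^ β * (n : ℝ) ^ (α - β) by
            rw [← Real.rpow_add (by linarith)]; ring_nf]
        ring
      _ ≤ _ := by
        gcongr
        linarith

/-- A sequence of iterated antiderivatives of `P_n^{(α,β)}`, given by Jacobi polynomials with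
lowered parameters as long as `n` is large compared to the order. -/
noncomputable def jacobiChain (α β : ℝ) (n : ℕ) : ℕ → ℝ → ℝ
  | 0 => jacobiP n α β
  | ℓ + 1 => fun u =>
      if 2 * (|α + β| + (ℓ + 1)) < n then
        (∏ i ∈ range (ℓ + 1), 2 / (n + α + β - i)) *
          jacobiP (n + (ℓ + 1)) (α - (ℓ + 1)) (β - (ℓ + 1)) u
      else ∫ v in (0 : ℝ)..u, jacobiChain α β n ℓ v

lemma jacobiChain_of_lt {α β : ℝ} {n : ℕ} : ∀ {ℓ : ℕ}, 2 * (|α + β| + ℓ) < n →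
    jacobiChain α β n ℓ = fun u => (∏ i ∈ range ℓ, 2 / (n + α + β - i)) *
      jacobiP (n + ℓ) (α - ℓ) (β - ℓ) u
  | 0, _ => by simp [jacobiChain]
  | ℓ + 1, h => by
    funext u
    push_cast at h
    simp only [jacobiChain, if_pos h]
    push_cast
    rfl

lemma continuous_jacobiChain (α β : ℝ) (n ℓ : ℕ) : Continuous (jacobiChain α β n ℓ) := by
  induction ℓ with
  | zero => exact continuous_jacobiP n α β
  | succ ℓ ih =>
    by_cases h : 2 * (|α + β| + (ℓ + 1)) < n
    · simp only [jacobiChain, if_pos h]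
      exact continuous_const.mul (continuous_jacobiP _ _ _)
    · simp only [jacobiChain, if_neg h]
      exact intervalIntegral.continuous_primitive (fun a b => ih.intervalIntegrable a b) 0

lemma hasDerivAt_jacobiChain (α β : ℝ) (n ℓ : ℕ) (u : ℝ) :
    HasDerivAt (jacobiChain α β n (ℓ + 1)) (jacobiChain α β n ℓ u) u := by
  by_cases h : 2 * (|α + β| + (ℓ + 1)) < n
  · rw [jacobiChain_of_lt (ℓ := ℓ) (by linarith), jacobiChain_of_lt (ℓ := ℓ + 1) (by push_cast; exact h)]
    have hpos : 0 < (n : ℝ) + α + β - ℓ := by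
      have := neg_abs_le (α + β)
      have := abs_nonneg (α + β)
      have : (0 : ℝ) ≤ ℓ := Nat.cast_nonneg _
      linarith
    refine ((hasDerivAt_jacobiP_succ (n + ℓ) (α - (ℓ + 1 : ℕ)) (β - (ℓ + 1 : ℕ)) u).const_mul
      (∏ i ∈ range (ℓ + 1), 2 / ((n : ℝ) + α + β - i))).congr_deriv ?_
    rw [prod_range_succ]
    push_cast
    rw [show α - (ℓ + 1) + 1 = α - ℓ by ring, show β - (ℓ + 1) + 1 = β - ℓ by ring,
      show (n : ℝ) + ℓ + (α - (ℓ + 1)) + (β - (ℓ + 1)) + 2 = n + α + β - ℓ by ring]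
    field_simp
  · simp only [jacobiChain, if_neg h]
    have hc := continuous_jacobiChain α β n ℓ
    exact intervalIntegral.integral_hasDerivAt_right (hc.intervalIntegrable _ _)
      (hc.stronglyMeasurableAtFilter _ _) hc.continuousAt

lemma exists_abs_jacobiChain_le {α β : ℝ} (hαβ : β ≤ α) (ℓ : ℕ) : ∃ C : ℝ, 0 < C ∧
    ∀ n : ℕ, 1 ≤ n → ∀ t ∈ Set.Icc (-1 : ℝ) 1, |jacobiChain α β n ℓ t| ≤
      C * ((n : ℝ) ^ (α - 2 * ℓ) * (1 + n * √(1 - |t|)) ^ (ℓ - α - 1 / 2)) := by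
  refine exists_bound_of_eventually_bound isCompact_Icc (fun n => jacobiChain α β n ℓ)
    (fun n t => (n : ℝ) ^ (α - 2 * ℓ) * (1 + n * √(1 - |t|)) ^ (ℓ - α - 1 / 2))
    (fun n => continuous_jacobiChain α β n ℓ)
    (fun n _ => (continuous_const.mul (continuous_one_add_mul_sqrt_rpow n _)).continuousOn)
    (fun n hn t _ => ?_) ?_
  · have : (0 : ℝ) < n := by exact_mod_cast hn
    positivity
  obtain ⟨C, hC, h⟩ := exists_abs_jacobiP_le (sub_le_sub_right hαβ (ℓ : ℝ))
  set c : ℝ := ℓ + 1 with hc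
  have hc1 : 1 ≤ c := by simp [hc]
  refine ⟨4 ^ ℓ * C * c ^ |α - ℓ| * c ^ |(ℓ : ℝ) - α - 1 / 2|, by positivity,
    ⌈2 * (|α + β| + ℓ)⌉₊ + 1, fun n hn hN t ht => ?_⟩
  have hn1 : (1 : ℝ) ≤ n := by exact_mod_cast hn
  have hgood : 2 * (|α + β| + ℓ) < n :=
    (Nat.le_ceil _).trans_lt (by exact_mod_cast Nat.lt_of_succ_le hN)
  rw [jacobiChain_of_lt hgood, abs_mul]
  have h1 : |∏ i ∈ range ℓ, 2 / ((n : ℝ) + α + β - i)| ≤ (4 / n) ^ ℓ := by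
    rw [abs_prod]
    refine (prod_le_prod (g := fun _ => (4 : ℝ) / n) (fun i _ => abs_nonneg _) fun i hi => ?_).trans_eq (by simp [div_pow])
    have hi' : (i : ℝ) < ℓ := by exact_mod_cast mem_range.1 hi
    have h2 : (n : ℝ) / 2 ≤ n + α + β - i := by
      linarith [neg_abs_le (α + β)]
    have h3 : 0 < (n : ℝ) + α + β - i := by linarith
    rw [abs_of_pos (by positivity), div_le_div_iff₀ h3 (by positivity)]
    linarith
  have h2 := h (n + ℓ) (by omega) t ht
  push_cast at h2
  have hl : (0 : ℝ) ≤ ℓ := Nat.cast_nonneg ℓ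
  have hs : 0 ≤ √(1 - |t|) := Real.sqrt_nonneg _
  have hle : (n : ℝ) + ℓ ≤ c * n := by rw [hc]; nlinarith
  have h3 : ((n : ℝ) + ℓ) ^ (α - ℓ) ≤ c ^ |α - ℓ| * (n : ℝ) ^ (α - ℓ) :=
    rpow_le_of_comparable _ (by linarith) (by linarith) hc1 hle (by nlinarith)
  have h4 : (1 + ((n : ℝ) + ℓ) * √(1 - |t|)) ^ (-(α - ℓ) - 1 / 2) ≤
      c ^ |(ℓ : ℝ) - α - 1 / 2| * (1 + n * √(1 - |t|)) ^ ((ℓ : ℝ) - α - 1 / 2) := by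
    rw [show -(α - ℓ) - 1 / 2 = (ℓ : ℝ) - α - 1 / 2 by ring]
    have h5 : ((n : ℝ) + ℓ) * √(1 - |t|) ≤ c * n * √(1 - |t|) := by gcongr
    have h6 : (n : ℝ) * √(1 - |t|) ≤ ((n : ℝ) + ℓ) * √(1 - |t|) := by gcongr; linarith
    have h7 : 0 ≤ (n : ℝ) * √(1 - |t|) := by positivity
    refine rpow_le_of_comparable _ (by linarith) (by linarith) hc1 (by nlinarith) (by nlinarith)
  have h8 : ((4 : ℝ) / n) ^ ℓ * (n : ℝ) ^ (α - ℓ) = 4 ^ ℓ * (n : ℝ) ^ (α - 2 * ℓ) := by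
    rw [div_pow, show α - ℓ = (α - 2 * ℓ) + ℓ by ring, Real.rpow_add_natCast (by linarith)]
    field_simp
  calc _ ≤ (4 / n) ^ ℓ * (C * ((c ^ |α - ℓ| * (n : ℝ) ^ (α - ℓ)) *
        (c ^ |(ℓ : ℝ) - α - 1 / 2| * (1 + n * √(1 - |t|)) ^ ((ℓ : ℝ) - α - 1 / 2)))) := by
        refine mul_le_mul h1 (h2.trans ?_) (abs_nonneg _) (by positivity)
        gcongr
    _ = (((4 : ℝ) / n) ^ ℓ * (n : ℝ) ^ (α - ℓ)) * (C * (c ^ |α - ℓ| *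
        (c ^ |(ℓ : ℝ) - α - 1 / 2| * (1 + n * √(1 - |t|)) ^ ((ℓ : ℝ) - α - 1 / 2)))) := by ring
    _ = _ := by rw [h8]; ring

/-- `g (ℓ + 1)` is an antiderivative of `g ℓ` for every `ℓ`. -/
def IsAntiderivChain (g : ℕ → ℝ → ℝ) : Prop :=
  (∀ ℓ, Continuous (g ℓ)) ∧ ∀ ℓ u, HasDerivAt (g (ℓ + 1)) (g ℓ u) u

/-- Smooth functions on `[0, 7/4]` that vanish on `(3/2, 7/4]`. -/
def IsCutoffSmooth (ψ : ℝ → ℝ) : Prop :=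
  ContDiffOn ℝ (⊤ : ℕ∞) ψ (Set.Icc 0 (7 / 4)) ∧ ∀ r ∈ Set.Ioc (3 / 2 : ℝ) (7 / 4), ψ r = 0

lemma IsCutoffSmooth.exists_bound {ψ : ℝ → ℝ} (hψ : IsCutoffSmooth ψ) :
    ∃ M : ℝ, 0 ≤ M ∧ ∀ r ∈ Set.Icc (0 : ℝ) (7 / 4), |ψ r| ≤ M := by
  obtain ⟨M, hM⟩ := isCompact_Icc.exists_bound_of_continuousOn hψ.1.continuousOn
  refine ⟨M, (norm_nonneg _).trans (hM 0 (by norm_num)), hM⟩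

lemma IsCutoffSmooth.exists_deriv {ψ : ℝ → ℝ} (hψ : IsCutoffSmooth ψ) (c : ℝ) :
    ∃ ψ' : ℝ → ℝ, IsCutoffSmooth (fun r => c * ψ r + r * ψ' r) ∧
      ∀ r ∈ Set.Ioo (0 : ℝ) (7 / 4), HasDerivAt ψ (ψ' r) r := by
  refine ⟨derivWithin ψ (Set.Icc 0 (7 / 4)), ⟨?_, fun r hr => ?_⟩, fun r hr => ?_⟩
  · have h1 := hψ.1.derivWithin (m := (⊤ : ℕ∞)) (uniqueDiffOn_Icc (by norm_num)) le_rfl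
    exact (contDiffOn_const.mul hψ.1).add (contDiffOn_id.mul h1)
  · have h1 : derivWithin ψ (Set.Icc 0 (7 / 4)) r = derivWithin (fun _ => 0) (Set.Icc 0 (7 / 4)) r := by
      refine Filter.EventuallyEq.derivWithin_eq ?_ (hψ.2 r hr)
      filter_upwards [self_mem_nhdsWithin, mem_nhdsWithin_of_mem_nhds (Ioi_mem_nhds hr.1)]
        with y hy hy' using hψ.2 y ⟨hy', hy.2⟩
    simp [h1, hψ.2 r hr]
  · have h1 := (hψ.1.differentiableOn (by simp) r (Set.Ioo_subset_Icc_self hr)).hasDerivWithinAt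
    exact h1.hasDerivAt (Icc_mem_nhds hr.1 hr.2)

lemma exists_tail_integral_bound_of_neg {η p : ℝ} {i : ℕ} {ψ : ℝ → ℝ} {C : ℕ → ℝ}
    (hC : ∀ ℓ, 0 ≤ C ℓ) (hψ : IsCutoffSmooth ψ) (hη : η + (i + p) / 2 < 0) :
    ∃ K : ℝ, 0 ≤ K ∧ ∀ g, IsAntiderivChain g → ∀ b : ℝ, 1 ≤ |b| →
      (∀ ℓ : ℕ, ∀ r ∈ Set.Icc (0 : ℝ) (7 / 4), |g ℓ (b * r)| ≤ C ℓ * (1 + |b| * r) ^ ((ℓ + p) / 2)) →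
      |∫ r in |b|⁻¹..(7 / 4), g i (b * r) * (r ^ (η - 1) * ψ r)| ≤ K * |b| ^ (-η) := by
  obtain ⟨M, hM0, hM⟩ := hψ.exists_bound
  set q : ℝ := (i + p) / 2 with hq
  have hηq : 0 < -(η + q) := by linarith
  refine ⟨C i * 2 ^ |q| * M / (-(η + q)), by have := hC i; positivity, fun g hg b hb hgb => ?_⟩
  have hb0 : 0 < |b| := by linarith
  have hbinv : |b|⁻¹ ≤ 1 := inv_le_one_of_one_le₀ hb
  have hbinv0 : 0 < |b|⁻¹ := inv_pos.2 hb0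
  have h0 : (0 : ℝ) ∉ Set.uIcc |b|⁻¹ (7 / 4) := by
    rw [Set.uIcc_of_le (by linarith)]
    exact fun h => absurd h.1 (by linarith)
  have hle : ∀ r ∈ Set.Ioc |b|⁻¹ (7 / 4), ‖g i (b * r) * (r ^ (η - 1) * ψ r)‖ ≤
      (C i * 2 ^ |q| * M * |b| ^ q) * r ^ (η + q - 1) := by
    intro r hr
    have hr0 : 0 < r := hbinv0.trans hr.1
    have hbr : 1 ≤ |b| * r := by
      have := mul_le_mul_of_nonneg_left hr.1.le hb0.le
      rwa [mul_inv_cancel₀ hb0.ne'] at this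
    have h1 := hgb i r ⟨hr0.le, hr.2⟩
    have h2 : (1 + |b| * r) ^ q ≤ 2 ^ |q| * (|b| ^ q * r ^ q) := by
      rw [← Real.mul_rpow hb0.le hr0.le]
      exact rpow_le_of_comparable _ (by linarith) (by linarith) (by norm_num) (by linarith)
        (by linarith)
    have h3 := hM r ⟨hr0.le, hr.2⟩
    rw [Real.norm_eq_abs, abs_mul, abs_mul, abs_of_nonneg (Real.rpow_nonneg hr0.le _)]
    have hCi := hC i
    calc _ ≤ (C i * (2 ^ |q| * (|b| ^ q * r ^ q))) * (r ^ (η - 1) * M) := by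
          refine mul_le_mul (h1.trans ?_) ?_ (by positivity) (by positivity) <;> gcongr
      _ = (C i * 2 ^ |q| * M * |b| ^ q) * (r ^ q * r ^ (η - 1)) := by ring
      _ = _ := by rw [← Real.rpow_add hr0]; ring_nf
  rw [← Real.norm_eq_abs]
  refine (intervalIntegral.norm_integral_le_of_norm_le (by linarith)
    (Filter.Eventually.of_forall hle)
    ((intervalIntegral.intervalIntegrable_rpow (Or.inr h0)).const_mul _)).trans ?_
  rw [intervalIntegral.integral_const_mul, integral_rpow (Or.inr ⟨by linarith, h0⟩)]
  have h4 : ((7 / 4 : ℝ) ^ (η + q - 1 + 1) - |b|⁻¹ ^ (η + q - 1 + 1)) / (η + q - 1 + 1) ≤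
      |b| ^ (-(η + q)) / (-(η + q)) := by
    rw [sub_add_cancel, Real.inv_rpow hb0.le, ← Real.rpow_neg hb0.le, ← neg_div_neg_eq]
    gcongr
    have : (0 : ℝ) ≤ (7 / 4 : ℝ) ^ (η + q) := by positivity
    linarith
  have hCi := hC i
  calc _ ≤ (C i * 2 ^ |q| * M * |b| ^ q) * (|b| ^ (-(η + q)) / (-(η + q))) := by gcongr
    _ = C i * 2 ^ |q| * M / (-(η + q)) * (|b| ^ q * |b| ^ (-(η + q))) := by ring
    _ = _ := by rw [← Real.rpow_add hb0]; ring_nf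

lemma exists_tail_integral_bound {C : ℕ → ℝ} (hC : ∀ ℓ, 0 ≤ C ℓ) {p : ℝ} (k : ℕ) :
    ∀ {η : ℝ} {i : ℕ} {ψ : ℝ → ℝ}, IsCutoffSmooth ψ → η + (i + p) / 2 < k / 2 →
    ∃ K : ℝ, 0 ≤ K ∧ ∀ g, IsAntiderivChain g → ∀ b : ℝ, 1 ≤ |b| →
      (∀ ℓ : ℕ, ∀ r ∈ Set.Icc (0 : ℝ) (7 / 4), |g ℓ (b * r)| ≤ C ℓ * (1 + |b| * r) ^ ((ℓ + p) / 2)) →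
      |∫ r in |b|⁻¹..(7 / 4), g i (b * r) * (r ^ (η - 1) * ψ r)| ≤ K * |b| ^ (-η) := by
  induction k with
  | zero =>
    intro η i ψ hψ h
    exact exists_tail_integral_bound_of_neg hC hψ (by simpa using h)
  | succ k ih =>
    intro η i ψ hψ h
    push_cast at h
    obtain ⟨ψ', hψ', hd⟩ := hψ.exists_deriv (η - 1)
    obtain ⟨M, hM0, hM⟩ := hψ.exists_bound
    obtain ⟨K, hK0, hK⟩ := ih (η := η - 1) (i := i + 1) hψ' (by push_cast; linarith)
    refine ⟨C (i + 1) * 2 ^ (((i + 1 : ℕ) + p) / 2) * M + K,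
      by have := hC (i + 1); positivity, fun g hg b hb hgb => ?_⟩
    have hb0 : 0 < |b| := by linarith
    have hbne : b ≠ 0 := abs_pos.1 hb0
    have hbinv : |b|⁻¹ ≤ 1 := inv_le_one_of_one_le₀ hb
    have hbinv0 : 0 < |b|⁻¹ := inv_pos.2 hb0
    have hle : |b|⁻¹ ≤ 7 / 4 := by linarith
    have hsub : Set.uIcc |b|⁻¹ (7 / 4) ⊆ Set.Icc (0 : ℝ) (7 / 4) := by
      rw [Set.uIcc_of_le hle]
      exact Set.Icc_subset_Icc_left hbinv0.le
    have hpos : ∀ r ∈ Set.uIcc |b|⁻¹ (7 / 4), 0 < r := by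
      rw [Set.uIcc_of_le hle]
      exact fun r hr => hbinv0.trans_le hr.1
    have hrp : ∀ e : ℝ, ContinuousOn (fun r : ℝ => r ^ e) (Set.uIcc |b|⁻¹ (7 / 4)) := fun e =>
      continuousOn_id.rpow_const fun r hr => Or.inl (hpos r hr).ne'
    have hgc : ∀ ℓ, Continuous fun r => g ℓ (b * r) := fun ℓ =>
      (hg.1 ℓ).comp (continuous_const.mul continuous_id)
    have hparts := intervalIntegral.integral_mul_deriv_eq_deriv_mul_of_hasDerivAt
      (a := |b|⁻¹) (b := 7 / 4)
      (u := fun r => r ^ (η - 1) * ψ r) (u' := fun r => r ^ (η - 1 - 1) * ((η - 1) * ψ r + r * ψ' r))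
      (v := fun r => g (i + 1) (b * r)) (v' := fun r => b * g i (b * r))
      ((hrp _).mul (hψ.1.continuousOn.mono hsub)) (hgc _).continuousOn ?_ ?_ ?_ ?_
    rotate_left
    · intro r hr
      rw [min_eq_left hle, max_eq_right hle] at hr
      have hr0 : 0 < r := hbinv0.trans hr.1
      refine ((Real.hasDerivAt_rpow_const (p := η - 1) (Or.inl hr0.ne')).mul
        (hd r ⟨hr0, hr.2⟩)).congr_deriv ?_
      rw [Real.rpow_sub_one hr0.ne' (η - 1)]
      field_simp
    · intro r _
      refine ((hg.2 i (b * r)).comp r ((hasDerivAt_id r).const_mul b)).congr_deriv ?_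
      simp [mul_comm]
    · exact ((hrp _).mul (hψ'.1.continuousOn.mono hsub)).intervalIntegrable
    · exact (continuous_const.mul (hgc i)).intervalIntegrable _ _
    have h74 : ψ (7 / 4) = 0 := hψ.2 _ (by norm_num)
    have h1 := hK g hg b hb hgb
    set I := ∫ r in |b|⁻¹..(7 / 4), g i (b * r) * (r ^ (η - 1) * ψ r) with hI
    set J := ∫ r in |b|⁻¹..(7 / 4), g (i + 1) (b * r) *
      (r ^ (η - 1 - 1) * ((η - 1) * ψ r + r * ψ' r)) with hJ
    have h2 : b * I = -(|b|⁻¹ ^ (η - 1) * ψ |b|⁻¹ * g (i + 1) (b * |b|⁻¹)) - J := by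
      rw [hI, hJ, ← intervalIntegral.integral_const_mul]
      simp only [h74, mul_zero, zero_mul, zero_sub] at hparts
      convert hparts using 1
      · congr 1; ext r; ring
      · congr 2; ext r; ring
    have h3 := hgb (i + 1) |b|⁻¹ ⟨hbinv0.le, hle⟩
    rw [mul_inv_cancel₀ hb0.ne', show (1 : ℝ) + 1 = 2 by norm_num] at h3
    have h4 := hM |b|⁻¹ ⟨hbinv0.le, hle⟩
    have h5 : |b|⁻¹ ^ (η - 1) = |b| ^ (-(η - 1)) := by
      rw [Real.inv_rpow hb0.le, ← Real.rpow_neg hb0.le]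
    have h6 : |b| * |I| ≤ (C (i + 1) * 2 ^ (((i + 1 : ℕ) + p) / 2) * M + K) * |b| ^ (-(η - 1)) := by
      rw [← abs_mul, h2]
      refine (abs_sub _ _).trans ?_
      rw [abs_neg, abs_mul, abs_mul, abs_of_nonneg (Real.rpow_nonneg hbinv0.le _), h5, add_mul]
      have hC' := hC (i + 1)
      refine add_le_add ?_ h1
      calc _ ≤ |b| ^ (-(η - 1)) * M * (C (i + 1) * 2 ^ (((i + 1 : ℕ) + p) / 2)) := by gcongr
        _ = _ := by ring
    rw [show -(η - 1) = -η + 1 by ring, Real.rpow_add_one hb0.ne'] at h6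
    nlinarith

lemma exists_half_integral_bound {κ : ℝ} (hκ : 0 < κ) {ψ : ℝ → ℝ} (hψ : IsCutoffSmooth ψ)
    {p : ℝ} (hp : 0 ≤ p) {C : ℕ → ℝ} (hC : ∀ ℓ, 0 ≤ C ℓ) :
    ∃ K : ℝ, 0 ≤ K ∧ ∀ g, IsAntiderivChain g → ∀ b : ℝ,
      (∀ ℓ : ℕ, ∀ r ∈ Set.Icc (0 : ℝ) (7 / 4), |g ℓ (b * r)| ≤ C ℓ * (1 + |b| * r) ^ ((ℓ + p) / 2)) →
      |∫ r in (0 : ℝ)..(7 / 4), g 0 (b * r) * (r ^ (κ - 1) * ψ r)| ≤ K * (1 + |b|) ^ (-κ) := by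
  obtain ⟨M, hM0, hM⟩ := hψ.exists_bound
  obtain ⟨k, hk⟩ := exists_nat_gt (2 * κ + p)
  obtain ⟨K, hK0, hK⟩ := exists_tail_integral_bound hC (p := p) k (η := κ) (i := 0) hψ
    (by push_cast; linarith)
  have hhead : ∀ g, IsAntiderivChain g → ∀ b : ℝ, ∀ c ∈ Set.Icc (0 : ℝ) (7 / 4), |b| * c ≤ 2 →
      (∀ ℓ : ℕ, ∀ r ∈ Set.Icc (0 : ℝ) (7 / 4),
        |g ℓ (b * r)| ≤ C ℓ * (1 + |b| * r) ^ ((ℓ + p) / 2)) →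
      |∫ r in (0 : ℝ)..c, g 0 (b * r) * (r ^ (κ - 1) * ψ r)| ≤ C 0 * 3 ^ (p / 2) * M / κ * c ^ κ := by
    intro g hg b c hc hbc hgb
    have hC0 := hC 0
    have hle : ∀ r ∈ Set.Ioc 0 c, ‖g 0 (b * r) * (r ^ (κ - 1) * ψ r)‖ ≤
        C 0 * 3 ^ (p / 2) * M * r ^ (κ - 1) := by
      intro r hr
      have hr' : r ∈ Set.Icc (0 : ℝ) (7 / 4) := ⟨hr.1.le, hr.2.trans hc.2⟩
      have h1 := hgb 0 r hr'
      rw [Nat.cast_zero, zero_add] at h1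
      have h2 := hM r hr'
      have h3 : |b| * r ≤ |b| * c := mul_le_mul_of_nonneg_left hr.2 (abs_nonneg b)
      have hr0 := hr.1
      rw [Real.norm_eq_abs, abs_mul, abs_mul, abs_of_nonneg (Real.rpow_nonneg hr.1.le _)]
      calc _ ≤ (C 0 * 3 ^ (p / 2)) * (r ^ (κ - 1) * M) := by
            refine mul_le_mul (h1.trans ?_) ?_ (by positivity) (by positivity)
            · gcongr
              linarith
            · gcongr
        _ = _ := by ring
    rw [← Real.norm_eq_abs]
    refine (intervalIntegral.norm_integral_le_of_norm_le hc.1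
      (Filter.Eventually.of_forall hle)
      ((intervalIntegral.intervalIntegrable_rpow' (by linarith)).const_mul _)).trans ?_
    rw [intervalIntegral.integral_const_mul, integral_rpow (Or.inl (by linarith)), sub_add_cancel,
      Real.zero_rpow hκ.ne', sub_zero]
    apply le_of_eq; ring
  have hC0 := hC 0
  have hH0 : 0 ≤ C 0 * 3 ^ (p / 2) * M / κ := by positivity
  refine ⟨2 ^ κ * (C 0 * 3 ^ (p / 2) * M / κ * (7 / 4) ^ κ + K), by positivity,
    fun g hg b hgb => ?_⟩
  rcases le_or_gt 1 |b| with hb | hb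
  · have hb0 : 0 < |b| := by linarith
    have hbinv : |b|⁻¹ ≤ 1 := inv_le_one_of_one_le₀ hb
    have hbinv0 : 0 < |b|⁻¹ := inv_pos.2 hb0
    have hint : ∀ x y, x ∈ Set.Icc (0 : ℝ) (7 / 4) → y ∈ Set.Icc (0 : ℝ) (7 / 4) →
        IntervalIntegrable (fun r => g 0 (b * r) * (r ^ (κ - 1) * ψ r)) volume x y := by
      intro x y hx hy
      have hs := Set.uIcc_subset_Icc hx hy
      refine IntervalIntegrable.continuousOn_mul ?_
        ((hg.1 0).comp (continuous_const.mul continuous_id)).continuousOn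
      exact (intervalIntegral.intervalIntegrable_rpow' (by linarith)).mul_continuousOn
        (hψ.1.continuousOn.mono hs)
    have hm : |b|⁻¹ ∈ Set.Icc (0 : ℝ) (7 / 4) := ⟨hbinv0.le, by linarith⟩
    rw [← intervalIntegral.integral_add_adjacent_intervals
      (hint 0 |b|⁻¹ (by norm_num) hm) (hint |b|⁻¹ (7 / 4) hm (by norm_num))]
    have h1 := hhead g hg b |b|⁻¹ hm (by rw [mul_inv_cancel₀ hb0.ne']; norm_num) hgb
    have h2 := hK g hg b hb hgb
    rw [Real.inv_rpow hb0.le, ← Real.rpow_neg hb0.le] at h1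
    have h3 : |b| ^ (-κ) ≤ 2 ^ κ * (1 + |b|) ^ (-κ) := by
      have := rpow_le_of_comparable (x := |b|) (y := 1 + |b|) (c := 2) (-κ) hb0 (by linarith)
        (by norm_num) (by linarith) (by linarith)
      rwa [abs_neg, abs_of_pos hκ] at this
    have h4 : (1 : ℝ) ≤ (7 / 4 : ℝ) ^ κ := Real.one_le_rpow (by norm_num) hκ.le
    refine (abs_add_le _ _).trans ((add_le_add h1 h2).trans ?_)
    calc _ = (C 0 * 3 ^ (p / 2) * M / κ + K) * |b| ^ (-κ) := by ring
      _ ≤ (C 0 * 3 ^ (p / 2) * M / κ * (7 / 4) ^ κ + K) * (2 ^ κ * (1 + |b|) ^ (-κ)) := by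
        gcongr
        exact le_mul_of_one_le_right hH0 h4
      _ = _ := by ring
  · have h1 := hhead g hg b (7 / 4) (by norm_num) (by linarith) hgb
    have h3 : 1 ≤ 2 ^ κ * (1 + |b|) ^ (-κ) := by
      have := rpow_le_of_comparable (x := 1) (y := 1 + |b|) (c := 2) (-κ) one_pos
        (by linarith [abs_nonneg b]) (by norm_num) (by linarith [abs_nonneg b]) (by linarith)
      rwa [abs_neg, abs_of_pos hκ, Real.one_rpow] at this
    refine h1.trans ?_
    calc _ ≤ C 0 * 3 ^ (p / 2) * M / κ * (7 / 4) ^ κ + K := by linarith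
      _ ≤ (C 0 * 3 ^ (p / 2) * M / κ * (7 / 4) ^ κ + K) * (2 ^ κ * (1 + |b|) ^ (-κ)) :=
        le_mul_of_one_le_right (by positivity) h3
      _ = _ := by ring

/-- The part of `[-1, 1]` at distance at most `7/4` from `e`. -/
def cornerSet (e : ℝ) : Set ℝ := {t | |t| ≤ 1 ∧ |t - e| ≤ 7 / 4}

/-- The weight `W`, concentrated near the endpoint `e`, gains a factor `(1 + |b|)^{-κ}` when
integrated against `g 0 (b (t - e))` for chains of antiderivatives of controlled growth. -/
def Decays (κ e : ℝ) (W : ℝ → ℝ) : Prop :=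
  Integrable W ∧ (∀ t, t ∉ cornerSet e → W t = 0) ∧
  ∀ p : ℝ, 0 ≤ p → ∀ C : ℕ → ℝ, (∀ ℓ, 0 ≤ C ℓ) → ∃ K : ℝ, 0 ≤ K ∧
    ∀ g, IsAntiderivChain g → ∀ b : ℝ,
      (∀ ℓ : ℕ, ∀ t ∈ cornerSet e,
        |g ℓ (b * (t - e))| ≤ C ℓ * (1 + |b * (t - e)|) ^ ((ℓ + p) / 2)) →
      |∫ t, g 0 (b * (t - e)) * W t| ≤ K * (1 + |b|) ^ (-κ)

lemma neg_mem_cornerSet {t : ℝ} (ht : t ∈ cornerSet 1) : -t ∈ cornerSet (-1) := by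
  refine ⟨by rw [abs_neg]; exact ht.1, ?_⟩
  rw [show -t - -1 = -(t - 1) by ring, abs_neg]
  exact ht.2

lemma Decays.neg {κ : ℝ} {W : ℝ → ℝ} (h : Decays κ 1 W) : Decays κ (-1) fun t => W (-t) := by
  refine ⟨h.1.comp_neg, fun t ht => h.2.1 _ fun ht' => ht ?_, fun p hp C hC => ?_⟩
  · simpa using neg_mem_cornerSet ht'
  · obtain ⟨K, hK0, hK⟩ := h.2.2 p hp C hC
    refine ⟨K, hK0, fun g hg b hgb => ?_⟩
    have h1 := hK g hg (-b) fun ℓ t ht => by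
      have := hgb ℓ (-t) (neg_mem_cornerSet ht)
      rwa [show b * (-t - -1) = -b * (t - 1) by ring] at this
    rw [abs_neg] at h1
    rw [← integral_neg_eq_self]
    convert h1 using 5
    · ring_nf
    · ring_nf

lemma decays_of_isCutoffSmooth {κ : ℝ} (hκ : 0 < κ) {ψ : ℝ → ℝ} (hψ : IsCutoffSmooth ψ) :
    Decays κ 1 fun t => (Set.Icc 0 (7 / 4)).indicator (fun r => r ^ (κ - 1) * ψ r) (1 - t) := by
  have hmem : ∀ r : ℝ, r ∈ Set.Icc (0 : ℝ) (7 / 4) → 1 - r ∈ cornerSet 1 := by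
    intro r hr
    refine ⟨abs_le.2 ⟨by linarith [hr.2], by linarith [hr.1]⟩, ?_⟩
    rw [show 1 - r - 1 = -r by ring, abs_neg, abs_of_nonneg hr.1]
    exact hr.2
  refine ⟨?_, fun t ht => ?_, fun p hp C hC => ?_⟩
  · refine Integrable.comp_sub_left (f := (Set.Icc (0 : ℝ) (7 / 4)).indicator
      (fun r => r ^ (κ - 1) * ψ r)) ?_ 1
    rw [integrable_indicator_iff measurableSet_Icc,
      integrableOn_Icc_iff_integrableOn_Ioc, ← intervalIntegrable_iff_integrableOn_Ioc_of_le (by norm_num)]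
    refine (intervalIntegral.intervalIntegrable_rpow' (by linarith)).mul_continuousOn
      (hψ.1.continuousOn.mono ?_)
    rw [Set.uIcc_of_le (by norm_num)]
  · refine Set.indicator_of_notMem (fun h => ht ?_) _
    simpa using hmem _ h
  · obtain ⟨K, hK0, hK⟩ := exists_half_integral_bound hκ hψ hp hC
    refine ⟨K, hK0, fun g hg b hgb => ?_⟩
    have h1 := hK g hg (-b) fun ℓ r hr => by
      have := hgb ℓ (1 - r) (hmem r hr)
      rwa [show b * (1 - r - 1) = -b * r by ring, abs_mul, abs_of_nonneg hr.1] at this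
    rw [abs_neg] at h1
    rw [← integral_sub_left_eq_self _ volume 1]
    rw [intervalIntegral.integral_of_le (by norm_num), ← integral_Icc_eq_integral_Ioc,
      ← integral_indicator measurableSet_Icc] at h1
    refine (congrArg abs (integral_congr_ae (Filter.Eventually.of_forall fun r => ?_))).trans_le h1
    beta_reduce
    by_cases hr : r ∈ Set.Icc (0 : ℝ) (7 / 4)
    · rw [show b * (1 - r - 1) = -b * r by ring]
      simp [hr]
    · simp [hr]

lemma isCutoffSmooth_of_contDiffOn (κ : ℝ) {φ : ℝ → ℝ}
    (hφ : ContDiffOn ℝ (⊤ : ℕ∞) φ (Set.Icc (-1) 1)) :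
    IsCutoffSmooth fun r => Real.smoothTransition (3 / 2 - r) * (φ (1 - r) * (2 - r) ^ (κ - 1)) := by
  refine ⟨?_, fun r hr => ?_⟩
  · refine ContDiffOn.mul ?_ (ContDiffOn.mul ?_ ?_)
    · exact (Real.smoothTransition.contDiff.comp (contDiff_const.sub contDiff_id)).contDiffOn
    · refine hφ.comp (contDiff_const.sub contDiff_id).contDiffOn fun r hr => ?_
      exact ⟨by linarith [hr.2], by linarith [hr.1]⟩
    · refine ContDiffOn.rpow_const_of_ne (contDiff_const.sub contDiff_id).contDiffOn fun r hr => ?_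
      have := hr.2
      linarith
  · simp only [Real.smoothTransition.zero_of_nonpos (show 3 / 2 - r ≤ 0 by linarith [hr.1]), zero_mul]

lemma smoothTransition_add_smoothTransition_one_sub (x : ℝ) :
    Real.smoothTransition x + Real.smoothTransition (1 - x) = 1 := by
  have h := Real.smoothTransition.pos_denom x
  rw [Real.smoothTransition, Real.smoothTransition, sub_sub_cancel,
    add_comm (expNegInvGlue (1 - x)), ← add_div, div_self h.ne']

lemma indicator_cutoff_eq (κ : ℝ) (φ : ℝ → ℝ) {t : ℝ} (ht : t ∈ Set.Icc (-1 : ℝ) 1) :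
    (Set.Icc 0 (7 / 4)).indicator (fun r => r ^ (κ - 1) *
      (Real.smoothTransition (3 / 2 - r) * (φ (1 - r) * (2 - r) ^ (κ - 1)))) (1 - t) =
    Real.smoothTransition (1 / 2 + t) * (φ t * (1 - t ^ 2) ^ (κ - 1)) := by
  by_cases h : 1 - t ∈ Set.Icc (0 : ℝ) (7 / 4)
  · rw [Set.indicator_of_mem h, show 1 - t ^ 2 = (1 - t) * (2 - (1 - t)) by ring,
      Real.mul_rpow h.1 (by linarith [h.2]), show 3 / 2 - (1 - t) = 1 / 2 + t by ring,
      sub_sub_cancel]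
    ring
  · have h2 : 7 / 4 < 1 - t := by
      by_contra h2
      exact h ⟨by linarith [ht.2], not_lt.1 h2⟩
    rw [Set.indicator_of_notMem h, Real.smoothTransition.zero_of_nonpos (by linarith), zero_mul]

lemma exists_decays_decomposition {κ : ℝ} (hκ : 0 < κ) {φ : ℝ → ℝ}
    (hφ : ContDiffOn ℝ (⊤ : ℕ∞) φ (Set.Icc (-1) 1)) :
    ∃ W : Bool → ℝ → ℝ, (∀ s, Decays κ (if s then 1 else -1) (W s)) ∧
      ∀ t, (Set.Icc (-1 : ℝ) 1).indicator (fun t => φ t * (1 - t ^ 2) ^ (κ - 1)) t =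
        ∑ s, W s t := by
  have hφ' : ContDiffOn ℝ (⊤ : ℕ∞) (fun t => φ (-t)) (Set.Icc (-1) 1) :=
    hφ.comp contDiff_neg.contDiffOn fun t ht => ⟨by linarith [ht.2], by linarith [ht.1]⟩
  have h₁ := decays_of_isCutoffSmooth hκ (isCutoffSmooth_of_contDiffOn κ hφ)
  have h₂ := (decays_of_isCutoffSmooth hκ (isCutoffSmooth_of_contDiffOn κ hφ')).neg
  suffices key : ∃ W₁ W₂ : ℝ → ℝ, Decays κ 1 W₁ ∧ Decays κ (-1) W₂ ∧
      ∀ t, (Set.Icc (-1 : ℝ) 1).indicator (fun t => φ t * (1 - t ^ 2) ^ (κ - 1)) t =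
        W₁ t + W₂ t by
    obtain ⟨W₁, W₂, h₁, h₂, h⟩ := key
    exact ⟨fun s => if s then W₁ else W₂, by rintro (_ | _) <;> simpa,
      fun t => by simpa [Fintype.sum_bool] using h t⟩
  refine ⟨_, _, h₁, h₂, fun t => ?_⟩
  by_cases ht : t ∈ Set.Icc (-1 : ℝ) 1
  · have ht' : -t ∈ Set.Icc (-1 : ℝ) 1 := ⟨by linarith [ht.2], by linarith [ht.1]⟩
    have h := smoothTransition_add_smoothTransition_one_sub (1 / 2 + t)
    rw [show 1 - (1 / 2 + t) = 1 / 2 + -t by ring] at h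
    have e₁ := indicator_cutoff_eq κ φ ht
    have e₂ := indicator_cutoff_eq κ (fun t => φ (-t)) ht'
    rw [e₁, e₂, Set.indicator_of_mem ht, neg_sq, neg_neg, ← add_mul, h, one_mul]
  · rw [Set.indicator_of_notMem ht]
    have hc : ∀ s, t ∉ cornerSet s := fun s h => ht (abs_le.1 h.1)
    exact ((congrArg₂ (· + ·) (h₁.2.1 t (hc _)) (h₂.2.1 t (hc _))).trans (add_zero 0)).symm

lemma Decays.exists_shifted_bound {κ e : ℝ} {W : ℝ → ℝ} (h : Decays κ e W) (hκ : 0 < κ) {p : ℝ}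
    (hp : 0 ≤ p) {C : ℕ → ℝ} (hC : ∀ ℓ, 0 ≤ C ℓ) :
    ∃ K : ℕ → ℝ, (∀ ℓ, 0 ≤ K ℓ) ∧ ∀ g, IsAntiderivChain g → ∀ b z : ℝ,
      (∀ ℓ : ℕ, ∀ t ∈ cornerSet e,
        |g ℓ (b * (t - e) + z)| ≤ C ℓ * (1 + |b * (t - e) + z|) ^ ((ℓ + p) / 2)) →
      ∀ ℓ : ℕ, |∫ t, g ℓ (b * (t - e) + z) * W t| ≤
        K ℓ * (1 + |b|) ^ (-κ) * (1 + |z|) ^ ((ℓ + (p + κ)) / 2) := by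
  choose K hK0 hK using fun ℓ : ℕ =>
    h.2.2 (ℓ + p) (by positivity) (fun i => C (ℓ + i)) fun i => hC _
  refine ⟨K, hK0, fun g hg b z hgb ℓ => ?_⟩
  obtain ⟨A, hA⟩ : ∃ A, A = √(1 + |z|) := ⟨_, rfl⟩
  have hA2 : A ^ 2 = 1 + |z| := by rw [hA, Real.sq_sqrt (by positivity)]
  have hA1 : 1 ≤ A := by rw [hA]; exact Real.one_le_sqrt.2 (by linarith [abs_nonneg z])
  have hA0 : 0 < A := by linarith
  have hpow : ∀ q : ℝ, (1 + |z|) ^ (q / 2) = A ^ q := by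
    intro q
    rw [← hA2, ← Real.rpow_natCast, ← Real.rpow_mul hA0.le]
    congr 1
    push_cast
    ring
  have hchain : IsAntiderivChain fun i w => A ^ (-(ℓ + p)) * (g (ℓ + i) (A * w + z) / A ^ i) := by
    refine ⟨fun i => ?_, fun i w => ?_⟩
    · have := hg.1 (ℓ + i)
      fun_prop
    · have h1 := (hg.2 (ℓ + i) (A * w + z)).comp w (((hasDerivAt_id w).const_mul A).add_const z)
      refine ((h1.div_const (A ^ (i + 1))).const_mul (A ^ (-(ℓ + p)))).congr_deriv ?_
      field_simp
      ring
  have h1 := hK ℓ _ hchain (b / A) fun i t ht => by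
    have h2 := hgb (ℓ + i) t ht
    have h3 : A * (b / A * (t - e)) = b * (t - e) := by field_simp
    rw [h3]
    set w := b / A * (t - e) with hw
    rw [← h3] at h2 ⊢
    have h4 : 1 + |A * w + z| ≤ (1 + |z|) * (1 + |w|) := by
      refine (add_le_add_right (abs_add_le _ _) 1).trans ?_
      rw [abs_mul, abs_of_pos hA0, ← hA2]
      have : A * |w| ≤ A ^ 2 * |w| := by
        gcongr
        nlinarith
      nlinarith
    rw [abs_mul, abs_div, abs_of_pos (pow_pos hA0 i), abs_of_pos (Real.rpow_pos_of_pos hA0 _)]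
    have h5 : |g (ℓ + i) (A * w + z)| ≤
        C (ℓ + i) * (A ^ (ℓ + p) * A ^ i * (1 + |w|) ^ ((i + (ℓ + p)) / 2)) := by
      refine h2.trans (mul_le_mul_of_nonneg_left ?_ (hC _))
      calc _ ≤ ((1 + |z|) * (1 + |w|)) ^ ((((ℓ + i : ℕ) : ℝ) + p) / 2) := by gcongr
        _ = _ := by
          rw [Real.mul_rpow (by positivity) (by positivity), hpow, ← Real.rpow_natCast,
            ← Real.rpow_add hA0]
          push_cast
          ring_nf
    rw [Real.rpow_neg hA0.le]
    have h6 : 0 < A ^ ((ℓ : ℝ) + p) := by positivity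
    calc _ ≤ (A ^ ((ℓ : ℝ) + p))⁻¹ * (C (ℓ + i) *
          (A ^ (ℓ + p) * A ^ i * (1 + |w|) ^ ((i + (ℓ + p)) / 2)) / A ^ i) := by gcongr
      _ = _ := by field_simp
  have h2 : ∀ t, A ^ (-(ℓ + p)) * (g (ℓ + 0) (A * (b / A * (t - e)) + z) / A ^ 0) * W t =
      A ^ (-(ℓ + p)) * (g ℓ (b * (t - e) + z) * W t) := by
    intro t
    rw [show A * (b / A * (t - e)) = b * (t - e) by field_simp, pow_zero, div_one, add_zero,
      mul_assoc]
  simp only [h2, integral_const_mul, abs_mul] at h1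
  rw [abs_of_pos (Real.rpow_pos_of_pos hA0 _), abs_div, abs_of_pos hA0] at h1
  have h3 : (1 + |b| / A) ^ (-κ) ≤ (1 + |b|) ^ (-κ) * A ^ κ := by
    calc _ ≤ ((1 + |b|) / A) ^ (-κ) := by
          refine Real.rpow_le_rpow_of_nonpos (by positivity) ?_ (by linarith)
          rw [add_div]
          gcongr
          exact (div_le_one hA0).2 hA1
      _ = _ := by
        rw [Real.div_rpow (by positivity) hA0.le, Real.rpow_neg hA0.le κ, div_inv_eq_mul]
  rw [hpow, show (ℓ : ℝ) + (p + κ) = (ℓ + p) + κ by ring, Real.rpow_add hA0]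
  have h4 := hK0 ℓ
  calc _ = A ^ ((ℓ : ℝ) + p) * (A ^ (-((ℓ : ℝ) + p)) * |∫ t, g ℓ (b * (t - e) + z) * W t|) := by
        rw [← mul_assoc, ← Real.rpow_add hA0]
        simp
    _ ≤ A ^ ((ℓ : ℝ) + p) * (K ℓ * ((1 + |b|) ^ (-κ) * A ^ κ)) :=
        mul_le_mul_of_nonneg_left (h1.trans (mul_le_mul_of_nonneg_left h3 h4)) (by positivity)
    _ = _ := by ring

lemma isAntiderivChain_integral {κ e : ℝ} {W : ℝ → ℝ} (h : Decays κ e W) {g : ℕ → ℝ → ℝ}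
    (hg : IsAntiderivChain g) (b c : ℝ) :
    IsAntiderivChain fun ℓ z => c * ∫ t, g ℓ (b * (t - e) + z) * W t := by
  have hmeas : ∀ ℓ z, AEStronglyMeasurable (fun t => g ℓ (b * (t - e) + z) * W t) := by
    intro ℓ z
    refine Continuous.aestronglyMeasurable ?_ |>.mul h.1.aestronglyMeasurable
    have := hg.1 ℓ
    fun_prop
  have hbound : ∀ ℓ z₀, ∃ M : ℝ, ∀ z ∈ Metric.ball z₀ 1, ∀ t,
      ‖g ℓ (b * (t - e) + z) * W t‖ ≤ M * ‖W t‖ := by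
    intro ℓ z₀
    obtain ⟨M, hM⟩ := (isCompact_closedBall z₀ (|b| * (7 / 4) + 1)).exists_bound_of_continuousOn
      (hg.1 ℓ).continuousOn
    refine ⟨M, fun z hz t => ?_⟩
    rw [norm_mul]
    by_cases ht : t ∈ cornerSet e
    · refine mul_le_mul_of_nonneg_right (hM _ ?_) (norm_nonneg _)
      rw [Metric.mem_ball, Real.dist_eq] at hz
      rw [Metric.mem_closedBall, Real.dist_eq, add_sub_assoc]
      refine (abs_add_le _ _).trans (add_le_add ?_ hz.le)
      rw [abs_mul]
      exact mul_le_mul_of_nonneg_left ht.2 (abs_nonneg b)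
    · simp [h.2.1 t ht]
  refine ⟨fun ℓ => continuous_const.mul (continuous_iff_continuousAt.2 fun z₀ => ?_),
    fun ℓ z₀ => HasDerivAt.const_mul c ?_⟩
  · obtain ⟨M, hM⟩ := hbound ℓ z₀
    refine continuousAt_of_dominated (bound := fun t => M * ‖W t‖)
      (Filter.Eventually.of_forall (hmeas ℓ)) ?_ (h.1.norm.const_mul M) ?_
    · filter_upwards [Metric.ball_mem_nhds z₀ one_pos] with z hz
        using Filter.Eventually.of_forall (hM z hz)
    · refine Filter.Eventually.of_forall fun t => Continuous.continuousAt ?_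
      have := hg.1 ℓ
      fun_prop
  · obtain ⟨M, hM⟩ := hbound ℓ z₀
    obtain ⟨M', hM'⟩ := hbound (ℓ + 1) z₀
    refine (hasDerivAt_integral_of_dominated_loc_of_deriv_le (bound := fun t => M * ‖W t‖)
      (F' := fun z t => g ℓ (b * (t - e) + z) * W t)
      (Metric.ball_mem_nhds z₀ one_pos) (Filter.Eventually.of_forall (hmeas (ℓ + 1)))
      ?_ (hmeas ℓ z₀) (Filter.Eventually.of_forall fun t z hz => hM z hz t)
      (h.1.norm.const_mul M) (Filter.Eventually.of_forall fun t z _ => ?_)).2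
    · exact (h.1.norm.const_mul M').mono' (hmeas _ _)
        (Filter.Eventually.of_forall (hM' z₀ (Metric.mem_ball_self one_pos)))
    · refine HasDerivAt.mul_const ?_ _
      exact ((hg.2 ℓ (b * (t - e) + z)).comp_const_add (b * (t - e)) z)

lemma integrable_comp_sum_mul_prod {m : ℕ} {κ e : Fin m → ℝ} {W : Fin m → ℝ → ℝ}
    (h : ∀ j, Decays (κ j) (e j) (W j)) {f : ℝ → ℝ} (hf : Continuous f) (b : Fin m → ℝ) :
    Integrable fun t : Fin m → ℝ => f (∑ j, b j * (t j - e j)) * ∏ j, W j (t j) := by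
  have hW : Integrable fun t : Fin m → ℝ => ∏ j, W j (t j) :=
    Integrable.fintype_prod fun j => (h j).1
  obtain ⟨M, hM⟩ := (isCompact_closedBall (0 : ℝ) (∑ j, |b j| * (7 / 4))).exists_bound_of_continuousOn
    hf.continuousOn
  refine (hW.norm.const_mul M).mono' (Continuous.aestronglyMeasurable (by fun_prop) |>.mul
    hW.aestronglyMeasurable) (Filter.Eventually.of_forall fun t => ?_)
  rw [norm_mul]
  by_cases ht : ∀ j, t j ∈ cornerSet (e j)
  · refine mul_le_mul_of_nonneg_right (hM _ ?_) (norm_nonneg _)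
    rw [mem_closedBall_zero_iff, Real.norm_eq_abs]
    refine (abs_sum_le_sum_abs _ _).trans (sum_le_sum fun j _ => ?_)
    rw [abs_mul]
    exact mul_le_mul_of_nonneg_left (ht j).2 (abs_nonneg _)
  · push Not at ht
    obtain ⟨j, hj⟩ := ht
    rw [prod_eq_zero (mem_univ j) ((h j).2.1 _ hj)]
    simp

lemma integral_pi_succ {m : ℕ} {F : (Fin (m + 1) → ℝ) → ℝ} (hF : Integrable F) :
    ∫ t, F t = ∫ y : Fin m → ℝ, ∫ x : ℝ, F (Fin.cons x y) := by
  have hmp := volume_preserving_piFinSuccAbove (fun _ : Fin (m + 1) => ℝ) 0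
  have hF' := hmp.symm.integrable_comp_of_integrable hF
  have h := integral_prod_symm _ hF'
  refine (hmp.symm.integral_comp' F).symm.trans (h.trans ?_)
  simp [MeasurableEquiv.piFinSuccAbove_symm_apply, Fin.insertNthEquiv]

lemma exists_integral_prod_bound (m : ℕ) : ∀ {κ e : Fin m → ℝ} {W : Fin m → ℝ → ℝ},
    (∀ j, 0 < κ j) → (∀ j, Decays (κ j) (e j) (W j)) → ∀ {p : ℝ}, 0 ≤ p → ∀ {C : ℕ → ℝ},
    (∀ ℓ, 0 ≤ C ℓ) → ∃ K : ℝ, 0 ≤ K ∧ ∀ g, IsAntiderivChain g → ∀ b : Fin m → ℝ,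
      (∀ ℓ : ℕ, ∀ t : Fin m → ℝ, (∀ j, t j ∈ cornerSet (e j)) →
        |g ℓ (∑ j, b j * (t j - e j))| ≤
          C ℓ * (1 + |∑ j, b j * (t j - e j)|) ^ ((ℓ + p) / 2)) →
      |∫ t : Fin m → ℝ, g 0 (∑ j, b j * (t j - e j)) * ∏ j, W j (t j)| ≤
        K * ∏ j, (1 + |b j|) ^ (-κ j) := by
  induction m with
  | zero =>
    intro κ e W _ _ p _ C hC
    refine ⟨C 0, hC 0, fun g _ b hgb => ?_⟩
    have h1 := hgb 0 0 fun j => j.elim0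
    rw [volume_pi, Measure.pi_of_empty _ 0]
    simpa using h1
  | succ m ih =>
    intro κ e W hκ hW p hp C hC
    obtain ⟨K, hK0, hK⟩ := (hW 0).exists_shifted_bound (hκ 0) hp hC
    obtain ⟨K', hK'0, hK'⟩ := ih (κ := fun j => κ j.succ) (fun j => hκ _) (fun j => hW j.succ)
      (add_nonneg hp (hκ 0).le) hK0
    refine ⟨K', hK'0, fun g hg b hgb => ?_⟩
    have hb0 : 0 < (1 + |b 0|) ^ (κ 0) := by positivity
    have h1 := hK' _ (isAntiderivChain_integral (hW 0) hg (b 0) ((1 + |b 0|) ^ (κ 0)))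
      (fun j => b j.succ) fun ℓ t ht => by
        have h2 := hK g hg (b 0) (∑ j, b j.succ * (t j - e j.succ)) (fun ℓ x hx => by
          have h3 := hgb ℓ (Fin.cons x t) (Fin.cases hx ht)
          simpa only [Fin.sum_univ_succ, Fin.cons_zero, Fin.cons_succ] using h3) ℓ
        rw [abs_mul, abs_of_pos hb0]
        calc _ ≤ (1 + |b 0|) ^ (κ 0) * (K ℓ * (1 + |b 0|) ^ (-κ 0) *
              (1 + |∑ j, b j.succ * (t j - e j.succ)|) ^ ((ℓ + (p + κ 0)) / 2)) := by gcongr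
          _ = ((1 + |b 0|) ^ (κ 0) * (1 + |b 0|) ^ (-κ 0)) * (K ℓ *
              (1 + |∑ j, b j.succ * (t j - e j.succ)|) ^ ((ℓ + (p + κ 0)) / 2)) := by ring
          _ = _ := by rw [← Real.rpow_add (by positivity)]; simp
    rw [integral_pi_succ (integrable_comp_sum_mul_prod hW (hg.1 0) b)]
    have h2 : ∀ y : Fin m → ℝ, (∫ x : ℝ, g 0 (∑ j, b j * ((Fin.cons x y : Fin (m + 1) → ℝ) j - e j)) *
        ∏ j, W j ((Fin.cons x y : Fin (m + 1) → ℝ) j)) =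
        (1 + |b 0|) ^ (-κ 0) * (((1 + |b 0|) ^ (κ 0) * ∫ x, g 0 (b 0 * (x - e 0) +
          ∑ j, b (Fin.succ j) * (y j - e (Fin.succ j))) * W 0 x) *
            ∏ j, W (Fin.succ j) (y j)) := by
      intro y
      rw [← mul_assoc, ← mul_assoc, ← Real.rpow_add (by positivity), neg_add_cancel,
        Real.rpow_zero, one_mul, ← integral_mul_const]
      refine integral_congr_ae (Filter.Eventually.of_forall fun x => ?_)
      simp [Fin.sum_univ_succ, Fin.prod_univ_succ, mul_assoc]
    simp only [h2]
    rw [integral_const_mul, abs_mul, abs_of_pos (by positivity), Fin.prod_univ_succ]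
    calc _ ≤ (1 + |b 0|) ^ (-κ 0) * (K' * ∏ j : Fin m, (1 + |b j.succ|) ^ (-κ j.succ)) := by gcongr
      _ = _ := by ring

lemma sqrt_le_sqrt_add_sqrt {x y z : ℝ} (hy : 0 ≤ y) (hz : 0 ≤ z) (h : x ≤ y + z) :
    √x ≤ √y + √z := by
  refine Real.sqrt_le_iff.2 ⟨by positivity, h.trans ?_⟩
  nlinarith [Real.sq_sqrt hy, Real.sq_sqrt hz, mul_nonneg (Real.sqrt_nonneg y) (Real.sqrt_nonneg z)]

lemma corner_scale_comparison {n v v₀ A z : ℝ} (hn : 0 < n) (hv₀ : 0 ≤ v₀) (hv : v₀ / 8 ≤ v)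
    (hA : A = (1 + n * √v₀) / n ^ 2) (hvz : v ≤ v₀ + A * |z|) :
    1 + n * √v₀ ≤ 3 * (1 + n * √v) ∧
      1 + n * √v ≤ 2 * (1 + n * √v₀) * √(1 + |z|) := by
  have hY1 : 1 ≤ 1 + n * √v₀ := by
    have : 0 ≤ n * √v₀ := by positivity
    linarith
  have hA0 : 0 < A := by rw [hA]; positivity
  constructor
  · have h1 : √v₀ ≤ 3 * √v := by
      refine Real.sqrt_le_iff.2 ⟨by positivity, ?_⟩
      rw [mul_pow, Real.sq_sqrt (by linarith)]
      linarith
    nlinarith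
  · have h1 := sqrt_le_sqrt_add_sqrt hv₀ (by positivity) hvz
    have h2 : n * √(A * |z|) ≤ (1 + n * √v₀) * √|z| := by
      rw [← Real.sqrt_sq hn.le, ← Real.sqrt_mul (by positivity), Real.sqrt_sq hn.le]
      refine Real.sqrt_le_iff.2 ⟨by positivity, ?_⟩
      rw [mul_pow, Real.sq_sqrt (abs_nonneg z), hA, ← mul_assoc,
        mul_div_cancel₀ _ (by positivity)]
      gcongr
      nlinarith
    have h3 : √|z| ≤ √(1 + |z|) := Real.sqrt_le_sqrt (by linarith)
    have h4 : 1 ≤ √(1 + |z|) := Real.one_le_sqrt.2 (by linarith [abs_nonneg z])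
    nlinarith

lemma abs_sum_mul_le {m : ℕ} {c : ℝ} (a t : Fin m → ℝ) (ht : ∀ j, |t j| ≤ c) :
    |∑ j, a j * t j| ≤ c * ∑ j, |a j| := by
  rw [mul_sum]
  refine (abs_sum_le_sum_abs _ _).trans (sum_le_sum fun j _ => ?_)
  rw [abs_mul, mul_comm]
  exact mul_le_mul_of_nonneg_right (ht j) (abs_nonneg _)

lemma exists_scaled_jacobiChain_bound {α β γ : ℝ} (hαβ : β ≤ α) (hγ : γ = α + 1 / 2)
    (hγ0 : 0 ≤ γ) : ∃ C : ℕ → ℝ, (∀ ℓ, 0 ≤ C ℓ) ∧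
      ∀ (m : ℕ) (e : Fin m → ℝ), (∀ j, e j = 1 ∨ e j = -1) →
      ∀ n : ℕ, 1 ≤ n → ∀ (a : Fin m → ℝ) (x A : ℝ), |x| + ∑ j, |a j| ≤ 1 →
      A = (1 + n * √(1 - |x + ∑ j, a j * e j|)) / n ^ 2 →
      ∀ ℓ : ℕ, ∀ t : Fin m → ℝ, (∀ j, t j ∈ cornerSet (e j)) → ∀ z : ℝ,
        A * z = ∑ j, a j * (t j - e j) →
        |(n : ℝ) ^ (-α) * (1 + n * √(1 - |x + ∑ j, a j * e j|)) ^ γ *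
          (jacobiChain α β n ℓ (A * z + (x + ∑ j, a j * e j)) / A ^ ℓ)| ≤
          C ℓ * (1 + |z|) ^ ((ℓ : ℝ) / 2) := by
  choose C hC0 hC using exists_abs_jacobiChain_le hαβ
  refine ⟨fun ℓ => C ℓ * 2 ^ ℓ * 3 ^ γ, fun ℓ => by have := hC0 ℓ; positivity, ?_⟩
  intro m e he n hn a x A hax hA ℓ t ht z hz
  have hn0 : (0 : ℝ) < n := by exact_mod_cast hn
  obtain ⟨u, hu⟩ : ∃ u, u = x + ∑ j, a j * t j := ⟨_, rfl⟩
  obtain ⟨u₀, hu₀⟩ : ∃ u₀, u₀ = x + ∑ j, a j * e j := ⟨_, rfl⟩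
  have hzu : A * z + (x + ∑ j, a j * e j) = u := by
    rw [hz, hu, add_left_comm, ← sum_add_distrib]
    congr 1
    exact sum_congr rfl fun j _ => by ring
  rw [hzu]
  rw [← hu₀] at hzu hA ⊢
  have habs : ∀ s : Fin m → ℝ, (∀ j, |s j| ≤ 1) → |x + ∑ j, a j * s j| ≤ 1 := fun s hs =>
    (abs_add_le _ _).trans (by linarith [abs_sum_mul_le a s hs])
  have hu1 : |u| ≤ 1 := hu ▸ habs t fun j => (ht j).1
  have hu₀1 : |u₀| ≤ 1 := hu₀ ▸ habs e fun j => by rcases he j with h | h <;> simp [h]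
  have h8 : |8 * u - u₀| ≤ 7 := by
    have h1 : 8 * u - u₀ = 7 * x + ∑ j, a j * (8 * t j - e j) := by
      rw [hu, hu₀, mul_add, mul_sum]
      simp only [mul_sub, sum_sub_distrib, mul_left_comm (8 : ℝ)]
      ring
    have h2 : |∑ j, a j * (8 * t j - e j)| ≤ 7 * ∑ j, |a j| := by
      refine abs_sum_mul_le _ _ fun j => ?_
      obtain ⟨h1, h2⟩ := ht j
      rw [abs_le] at h1 h2 ⊢
      rcases he j with h | h <;> rw [h] at h2 ⊢ <;> constructor <;> linarith
    rw [h1]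
    refine (abs_add_le _ _).trans ?_
    rw [abs_mul, abs_of_pos (by norm_num : (0 : ℝ) < 7)]
    linarith
  have hA0 : 0 < A := by rw [hA]; positivity
  have hv8 : (1 - |u₀|) / 8 ≤ 1 - |u| := by
    have h1 : 8 * |u| ≤ |8 * u - u₀| + |u₀| := by
      have := abs_add_le (8 * u - u₀) u₀
      rwa [sub_add_cancel, abs_mul, abs_of_pos (by norm_num : (0 : ℝ) < 8)] at this
    linarith
  have hvz : 1 - |u| ≤ 1 - |u₀| + A * |z| := by
    have h1 : |u₀| ≤ |u| + |A * z| := by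
      have := abs_sub u (A * z)
      rwa [← hzu, add_sub_cancel_left, hzu] at this
    rw [abs_mul, abs_of_pos hA0] at h1
    linarith
  obtain ⟨h3, h2⟩ := corner_scale_comparison hn0 (by linarith) hv8 hA hvz
  have hF := hC ℓ n hn u (abs_le.1 hu1)
  obtain ⟨Y, hY⟩ : ∃ Y, Y = 1 + n * √(1 - |u|) := ⟨_, rfl⟩
  obtain ⟨Y₀, hY₀⟩ : ∃ Y₀, Y₀ = 1 + n * √(1 - |u₀|) := ⟨_, rfl⟩
  have hYpos : 0 < Y := by rw [hY]; positivity
  have hY₀pos : 0 < Y₀ := by rw [hY₀]; positivity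
  rw [← hY, ← hY₀] at h2 h3
  rw [← hY, show (ℓ : ℝ) - α - 1 / 2 = ℓ - γ by rw [hγ]; ring] at hF
  rw [← hY₀] at hA ⊢
  rw [abs_mul, abs_div, abs_of_pos (pow_pos hA0 ℓ), abs_of_pos (by positivity)]
  have hsq : (1 + |z|) ^ ((ℓ : ℝ) / 2) = √(1 + |z|) ^ ℓ := by
    rw [Real.sqrt_eq_rpow, ← Real.rpow_natCast, ← Real.rpow_mul (by positivity)]
    congr 1
    ring
  have hCℓ := hC0 ℓ
  calc _ ≤ (n : ℝ) ^ (-α) * Y₀ ^ γ * (C ℓ * ((n : ℝ) ^ (α - 2 * ℓ) * Y ^ ((ℓ : ℝ) - γ)) / A ^ ℓ) := by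
        gcongr
    _ = C ℓ * (Y / Y₀) ^ ℓ * (Y₀ / Y) ^ γ := by
        have h4 : (n : ℝ) ^ (α - 2 * ℓ) = n ^ α / (n ^ 2) ^ ℓ := by
          rw [Real.rpow_sub hn0, ← pow_mul, ← Real.rpow_natCast]
          push_cast
          rfl
        rw [h4, Real.rpow_neg hn0.le, Real.rpow_sub hYpos, Real.rpow_natCast, hA,
          Real.div_rpow hY₀pos.le hYpos.le, div_pow, div_pow]
        have h5 : 0 < (n : ℝ) ^ α := by positivity
        have h6 : 0 < Y ^ γ := by positivity
        field_simp
    _ ≤ C ℓ * (2 * √(1 + |z|)) ^ ℓ * 3 ^ γ := by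
        gcongr
        · rw [div_le_iff₀ hY₀pos]
          linarith
        · rwa [div_le_iff₀ hYpos]
    _ = _ := by rw [hsq, mul_pow]; ring

lemma exists_corner_integral_bound {m : ℕ} {κ e : Fin m → ℝ} {W : Fin m → ℝ → ℝ}
    (hκ : ∀ j, 0 < κ j) (he : ∀ j, e j = 1 ∨ e j = -1) (hW : ∀ j, Decays (κ j) (e j) (W j))
    {α β : ℝ} (hαβ : β ≤ α) (hα : (∑ j, κ j) - 1 / 2 ≤ α) :
    ∃ K : ℝ, 0 ≤ K ∧ ∀ n : ℕ, 1 ≤ n → ∀ (a : Fin m → ℝ) (x : ℝ), |x| + ∑ j, |a j| ≤ 1 →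
      |∫ t : Fin m → ℝ, jacobiP n α β ((∑ j, a j * t j) + x) * ∏ j, W j (t j)| ≤
        K * ((n : ℝ) ^ (α - 2 * ∑ j, κ j) *
          ((1 + (n : ℝ) * √(1 - (∑ j, |a j|) - |x|)) ^ (-α - 1 / 2 + ∑ j, κ j)) *
          ∏ j, (|a j| + (n : ℝ)⁻¹ * √(1 - (∑ j, |a j|) - |x|) + ((n : ℝ) ^ 2)⁻¹) ^ (-κ j)) := by
  obtain ⟨σ, hσ⟩ : ∃ σ, σ = ∑ j, κ j := ⟨_, rfl⟩
  have hσ0 : 0 ≤ σ := hσ ▸ sum_nonneg fun j _ => (hκ j).le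
  rw [← hσ] at hα ⊢
  obtain ⟨γ, hγ⟩ : ∃ γ, γ = α + 1 / 2 := ⟨_, rfl⟩
  obtain ⟨C, hC0, hC⟩ := exists_scaled_jacobiChain_bound hαβ hγ (by linarith)
  obtain ⟨K, hK0, hK⟩ := exists_integral_prod_bound m hκ hW le_rfl hC0
  refine ⟨K, hK0, fun n hn a x hax => ?_⟩
  have hn0 : (0 : ℝ) < n := by exact_mod_cast hn
  obtain ⟨u₀, hu₀⟩ : ∃ u₀, u₀ = x + ∑ j, a j * e j := ⟨_, rfl⟩
  obtain ⟨Y₀, hY₀⟩ : ∃ Y₀, Y₀ = 1 + n * √(1 - |u₀|) := ⟨_, rfl⟩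
  obtain ⟨A, hA⟩ : ∃ A, A = Y₀ / (n : ℝ) ^ 2 := ⟨_, rfl⟩
  have hY₀pos : 0 < Y₀ := by rw [hY₀]; positivity
  have hA0 : 0 < A := by rw [hA]; positivity
  have hsum : ∀ t : Fin m → ℝ, A * ∑ j, a j / A * (t j - e j) = ∑ j, a j * (t j - e j) := by
    intro t
    rw [mul_sum]
    exact sum_congr rfl fun j _ => by field_simp
  have hchain : IsAntiderivChain fun ℓ z =>
      (n : ℝ) ^ (-α) * Y₀ ^ γ * (jacobiChain α β n ℓ (A * z + u₀) / A ^ ℓ) := by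
    refine ⟨fun ℓ => ?_, fun ℓ z => ?_⟩
    · have := continuous_jacobiChain α β n ℓ
      fun_prop
    · have h1 := (hasDerivAt_jacobiChain α β n ℓ (A * z + u₀)).comp z
        (((hasDerivAt_id z).const_mul A).add_const u₀)
      refine ((h1.div_const (A ^ (ℓ + 1))).const_mul ((n : ℝ) ^ (-α) * Y₀ ^ γ)).congr_deriv ?_
      field_simp
      ring
  have hmain := hK _ hchain (fun j => a j / A) fun ℓ t ht => by
    have := hC m e he n hn a x A hax (by rw [hA, hY₀, hu₀]) ℓ t ht _ (hsum t)
    rw [add_zero, hY₀, hu₀]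
    exact this
  have hfun : ∀ t : Fin m → ℝ, (n : ℝ) ^ (-α) * Y₀ ^ γ * (jacobiChain α β n 0
      (A * ∑ j, a j / A * (t j - e j) + u₀) / A ^ 0) * ∏ j, W j (t j) =
      (n : ℝ) ^ (-α) * Y₀ ^ γ * (jacobiP n α β ((∑ j, a j * t j) + x) * ∏ j, W j (t j)) := by
    intro t
    have harg : ∑ j, a j * (t j - e j) + (x + ∑ j, a j * e j) = (∑ j, a j * t j) + x := by
      simp only [mul_sub, sum_sub_distrib]
      ring
    rw [hsum, hu₀, harg, pow_zero, div_one, jacobiChain, mul_assoc]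
  simp only [hfun] at hmain
  rw [integral_const_mul, abs_mul, abs_of_pos (by positivity)] at hmain
  obtain ⟨s, hs⟩ : ∃ s, s = 1 - (∑ j, |a j|) - |x| := ⟨_, rfl⟩
  obtain ⟨Y, hY⟩ : ∃ Y, Y = 1 + (n : ℝ) * √s := ⟨_, rfl⟩
  have hYpos : 0 < Y := by rw [hY]; positivity
  have hu₀s : s ≤ 1 - |u₀| := by
    have h1 := abs_sum_mul_le a e (c := 1) fun j => by rcases he j with h | h <;> simp [h]
    have h2 := abs_add_le x (∑ j, a j * e j)
    rw [hs, hu₀]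
    linarith
  have hYY₀ : Y ≤ Y₀ := by
    rw [hY, hY₀]
    gcongr
  have hprod : ∏ j, (1 + |a j / A|) ^ (-κ j) =
      (Y₀ ^ σ * ((n : ℝ) ^ (2 * σ))⁻¹) * ∏ j, (|a j| + A) ^ (-κ j) := by
    have h1 : ∀ j, (1 + |a j / A|) ^ (-κ j) = A ^ (κ j) * (|a j| + A) ^ (-κ j) := by
      intro j
      rw [abs_div, abs_of_pos hA0, show 1 + |a j| / A = (|a j| + A) / A by field_simp; ring,
        Real.div_rpow (by positivity) hA0.le, Real.rpow_neg hA0.le, div_inv_eq_mul, mul_comm]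
    rw [prod_congr rfl fun j _ => h1 j, prod_mul_distrib, ← Real.rpow_sum_of_pos hA0, ← hσ, hA,
      Real.div_rpow hY₀pos.le (by positivity), ← Real.rpow_natCast, ← Real.rpow_mul hn0.le]
    push_cast
    rw [div_eq_mul_inv]
  have hprod' : ∏ j, (|a j| + A) ^ (-κ j) ≤
      ∏ j, (|a j| + (n : ℝ)⁻¹ * √s + ((n : ℝ) ^ 2)⁻¹) ^ (-κ j) := by
    refine prod_le_prod (fun j _ => by positivity) fun j _ => ?_
    refine Real.rpow_le_rpow_of_nonpos (by positivity) ?_ (by linarith [hκ j])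
    have h1 : (n : ℝ)⁻¹ * √s + ((n : ℝ) ^ 2)⁻¹ = Y / (n : ℝ) ^ 2 := by
      rw [hY]
      field_simp
      ring
    have h2 : Y / (n : ℝ) ^ 2 ≤ A := by rw [hA]; gcongr
    linarith
  have hpow : Y₀ ^ (-γ + σ) ≤ Y ^ (-γ + σ) :=
    Real.rpow_le_rpow_of_nonpos hYpos hYY₀ (by linarith)
  rw [← hs, ← hY, show -α - 1 / 2 + σ = -γ + σ by rw [hγ]; ring]
  set I := |∫ t : Fin m → ℝ, jacobiP n α β ((∑ j, a j * t j) + x) * ∏ j, W j (t j)|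
  set Q := ∏ j, (|a j| + (n : ℝ)⁻¹ * √s + ((n : ℝ) ^ 2)⁻¹) ^ (-κ j)
  rw [hprod] at hmain
  have hQ0 : 0 ≤ ∏ j, (|a j| + A) ^ (-κ j) := prod_nonneg fun j _ => by positivity
  calc I = (n : ℝ) ^ α * Y₀ ^ (-γ) * ((n : ℝ) ^ (-α) * Y₀ ^ γ * I) := by
        rw [Real.rpow_neg hn0.le, Real.rpow_neg hY₀pos.le]
        have h5 : 0 < (n : ℝ) ^ α := by positivity
        have h6 : 0 < Y₀ ^ γ := by positivity
        field_simp
    _ ≤ (n : ℝ) ^ α * Y₀ ^ (-γ) * (K * (Y₀ ^ σ * ((n : ℝ) ^ (2 * σ))⁻¹ *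
        ∏ j, (|a j| + A) ^ (-κ j))) := by gcongr
    _ = K * ((n : ℝ) ^ (α - 2 * σ) * Y₀ ^ (-γ + σ) * ∏ j, (|a j| + A) ^ (-κ j)) := by
        rw [Real.rpow_sub hn0, Real.rpow_add hY₀pos]
        ring
    _ ≤ _ := by gcongr

lemma setIntegral_cube_eq_integral_indicator {m : ℕ} (F : (Fin m → ℝ) → ℝ)
    (w : Fin m → ℝ → ℝ) :
    ∫ t in cube m, F t * ∏ j, w j (t j) =
      ∫ t, F t * ∏ j, (Set.Icc (-1 : ℝ) 1).indicator (w j) (t j) := by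
  rw [cube, ← integral_indicator (MeasurableSet.univ_pi fun _ => measurableSet_Icc)]
  refine integral_congr_ae (Filter.Eventually.of_forall fun t => ?_)
  by_cases ht : t ∈ cube m
  · rw [← cube, Set.indicator_of_mem ht]
    congr 1
    exact prod_congr rfl fun j _ => (Set.indicator_of_mem (ht j (Set.mem_univ j)) _).symm
  · rw [← cube, Set.indicator_of_notMem ht]
    obtain ⟨j, hj⟩ : ∃ j, t j ∉ Set.Icc (-1 : ℝ) 1 := by
      by_contra! h
      exact ht fun j _ => h j
    have h0 := prod_eq_zero (f := fun j => (Set.Icc (-1 : ℝ) 1).indicator (w j) (t j))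
      (mem_univ j) (Set.indicator_of_notMem hj _)
    dsimp only
    rw [h0, mul_zero]

/-- Theorem 3.1, main estimate: for `κ_j > 0`, `φ_j ∈ C^∞[-1,1]`,
`α ≥ β`, `α ≥ |κ| - 1/2`, there is `c > 0` such that for `n ≥ 1`, `a_j ≠ 0`,
`|a| ≤ 1` and `|x| + |a| ≤ 1`,
`|∫_{[-1,1]^m} P_n^{(α,β)}(Σ a_j t_j + x) ∏ φ_j(t_j)(1-t_j²)^{κ_j-1} dt|
  ≤ c n^{α-2|κ|} (1+n√(1-|a|-|x|))^{-α-1/2+|κ|} ∏ (|a_j|+n⁻¹√(1-|a|-|x|)+n⁻²)^{-κ_j}`. -/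
theorem main_estimate_jacobi_integral (m : ℕ) (hm : 1 ≤ m) (κ : Fin m → ℝ)
    (hκ : ∀ j, 0 < κ j) (φ : Fin m → ℝ → ℝ)
    (hφ : ∀ j, ContDiffOn ℝ (⊤ : ℕ∞) (φ j) (Set.Icc (-1) 1))
    (α β : ℝ) (hαβ : β ≤ α) (hα : (∑ j, κ j) - 1 / 2 ≤ α) :
    ∃ c : ℝ, 0 < c ∧ ∀ n : ℕ, 1 ≤ n → ∀ a : Fin m → ℝ, (∀ j, a j ≠ 0) →
      (∑ j, |a j|) ≤ 1 → ∀ x : ℝ, |x| + ∑ j, |a j| ≤ 1 →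
      |∫ t in cube m,
          jacobiP n α β ((∑ j, a j * t j) + x) * ∏ j, φ j (t j) * (1 - t j ^ 2) ^ (κ j - 1)| ≤
        c * (n : ℝ) ^ (α - 2 * ∑ j, κ j) *
          ((1 + (n : ℝ) * Real.sqrt (1 - (∑ j, |a j|) - |x|)) ^ (-α - 1 / 2 + ∑ j, κ j)) *
          ∏ j, (|a j| + (n : ℝ)⁻¹ * Real.sqrt (1 - (∑ j, |a j|) - |x|) +
            ((n : ℝ) ^ 2)⁻¹) ^ (-κ j) := by
  choose W hW hsum using fun j => exists_decays_decomposition (hκ j) (hφ j)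
  choose K hK0 hK using fun p : Fin m → Bool =>
    exists_corner_integral_bound (e := fun j => if p j then 1 else -1) (W := fun j => W j (p j))
      hκ (fun j => by cases p j <;> simp) (fun j => hW j (p j)) hαβ hα
  refine ⟨1 + ∑ p, K p, add_pos_of_pos_of_nonneg one_pos (sum_nonneg fun p _ => hK0 p),
    fun n hn a _ _ x hax => ?_⟩
  rw [setIntegral_cube_eq_integral_indicator (fun t => jacobiP n α β ((∑ j, a j * t j) + x))
    fun j t => φ j t * (1 - t ^ 2) ^ (κ j - 1)]
  have hexp : ∀ t : Fin m → ℝ, jacobiP n α β ((∑ j, a j * t j) + x) *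
      ∏ j, (Set.Icc (-1 : ℝ) 1).indicator (fun t => φ j t * (1 - t ^ 2) ^ (κ j - 1)) (t j) =
      ∑ p : Fin m → Bool, jacobiP n α β ((∑ j, a j * t j) + x) * ∏ j, W j (p j) (t j) := by
    intro t
    simp only [hsum, prod_univ_sum, Fintype.piFinset_univ, mul_sum]
  have hint : ∀ p : Fin m → Bool, Integrable fun t : Fin m → ℝ =>
      jacobiP n α β ((∑ j, a j * t j) + x) * ∏ j, W j (p j) (t j) := by
    intro p
    have hcont := continuous_jacobiP n α β
    have := integrable_comp_sum_mul_prod (fun j => hW j (p j))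
      (f := fun y => jacobiP n α β (y + ((∑ j, a j * (if p j then 1 else -1)) + x)))
      (by fun_prop) a
    refine this.congr (Filter.Eventually.of_forall fun t => ?_)
    have harg : ∑ j, a j * (t j - if p j then 1 else -1) +
        ((∑ j, a j * if p j then 1 else -1) + x) = (∑ j, a j * t j) + x := by
      simp only [mul_sub, sum_sub_distrib]
      ring
    dsimp only
    rw [harg]
  simp only [hexp]
  rw [integral_finsetSum _ fun p _ => hint p]
  refine (abs_sum_le_sum_abs _ _).trans ((sum_le_sum fun p _ => hK p n hn a x hax).trans ?_)
  rw [← sum_mul, ← mul_assoc, ← mul_assoc]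
  have hs : 0 ≤ 1 + (n : ℝ) * √(1 - (∑ j, |a j|) - |x|) := by positivity
  have hprod : 0 ≤ ∏ j, (|a j| + (n : ℝ)⁻¹ * √(1 - (∑ j, |a j|) - |x|) +
      ((n : ℝ) ^ 2)⁻¹) ^ (-κ j) := prod_nonneg fun j _ => by positivity
  refine mul_le_mul_of_nonneg_right (mul_le_mul_of_nonneg_right (mul_le_mul_of_nonneg_right
    (by linarith) (by positivity)) (by positivity)) hprod
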